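/- Fix p ∈ (1,∞) and let σ be any Borel probability measure on 𝕊 whose n-th coordinate marginal equals σ_n for every n ∈ ℕ. Then for σ-almost every θ ∈ 𝕊, the sequence (W_θ^{(n,p)})_{n∈ℕ} satisfies a large deviation principle with speed n and rate function 𝕀^q_{p,μ₂}; moreover 𝕀^q_{p,μ₂} is a quasiconvex, symmetric, good rate function (in particular, the rate function is the same for σ-a.e. θ). -/

import Mathlib

open MeasureTheory Filter Topology Set ProbabilityTheory
open scoped ENNReal NNReal

noncomputable section

namespace LDP

/-- The nonnegative part of an extended real, as an extended nonnegative real. -/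
def erealToENNReal (x : EReal) : ℝ≥0∞ := if x = ⊤ then ⊤ else ENNReal.ofReal x.toReal

/-- Extended (possibly infinite) integral of an `EReal`-valued function:
positive part minus negative part. -/
def eIntegral (ν : Measure ℝ) (f : ℝ → EReal) : EReal :=
  ((∫⁻ u, erealToENNReal (f u) ∂ν : ℝ≥0∞) : EReal)
    - ((∫⁻ u, erealToENNReal (-f u) ∂ν : ℝ≥0∞) : EReal)

/-- `q`-th absolute moment of a measure on `ℝ`. -/
def mom (q : ℝ) (ν : Measure ℝ) : ℝ≥0∞ := ∫⁻ x, ENNReal.ofReal (|x| ^ q) ∂ν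

open Classical in
/-- Relative entropy `H(ν|μ)`. -/
def relEnt (ν μ : Measure ℝ) : EReal :=
  if ν ≪ μ then eIntegral ν (fun x => ENNReal.log (ν.rnDeriv μ x)) else ⊤

/-- The generalized normal distribution `μ_p` on `ℝ`. -/
def muP (p : ℝ) : Measure ℝ :=
  volume.withDensity fun y =>
    ENNReal.ofReal ((2 * p ^ (1/p) * Real.Gamma (1 + 1/p))⁻¹ * Real.exp (-(|y| ^ p) / p))

/-- The uniform probability measure `μ_∞` on `[-1,1]`. -/
def muInf : Measure ℝ := (volume (Icc (-1:ℝ) 1))⁻¹ • volume.restrict (Icc (-1:ℝ) 1)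

/-- Extended-real-valued log moment generating function of a measure on `ℝ`. -/
def logM (γ : Measure ℝ) (t : ℝ) : EReal :=
  ENNReal.log (∫⁻ y, ENNReal.ofReal (Real.exp (t * y)) ∂γ)

/-- The class `𝒯_q` of measures whose log mgf is dominated by `C|t|^{q/(q-1)} + C`. -/
def memT (q : ℝ) (γ : Measure ℝ) : Prop :=
  ∃ C : ℝ, ∀ t : ℝ, logM γ t ≤ ((C * |t| ^ (q/(q-1)) + C : ℝ) : EReal)

/-- Legendre transform of a function of one real variable. -/
def legendre1 (Λ : ℝ → EReal) (τ : ℝ) : EReal := ⨆ t : ℝ, ((t * τ : ℝ) : EReal) - Λ t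

/-- Legendre transform of a function of two real variables. -/
def legendre2 (Λ : ℝ × ℝ → EReal) (τ : ℝ × ℝ) : EReal :=
  ⨆ t : ℝ × ℝ, ((t.1 * τ.1 + t.2 * τ.2 : ℝ) : EReal) - Λ t

/-- Legendre transform of a function of three real variables. -/
def legendre3 (Λ : ℝ × ℝ × ℝ → EReal) (τ : ℝ × ℝ × ℝ) : EReal :=
  ⨆ t : ℝ × ℝ × ℝ, ((t.1 * τ.1 + t.2.1 * τ.2.1 + t.2.2 * τ.2.2 : ℝ) : EReal) - Λ t

/-- `Φ_p(t₀,t₁,t₂) = log ∫∫ exp(t₀ z² + t₁ z y + t₂ |y|^p) μ₂(dz) μ_p(dy)`. -/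
def Phi (p : ℝ) (t : ℝ × ℝ × ℝ) : EReal :=
  ENNReal.log (∫⁻ y, (∫⁻ z,
    ENNReal.ofReal (Real.exp (t.1 * z^2 + t.2.1 * z * y + t.2.2 * |y| ^ p)) ∂(muP 2)) ∂(muP p))

/-- The annealed rate function `𝕀ᵃ_p` for `p ∈ [2,∞)`. -/
def Ia (p : ℝ) (w : ℝ) : EReal :=
  ⨅ τ ∈ {τ : ℝ × ℝ × ℝ | 0 < τ.1 ∧ 0 < τ.2.2 ∧
      τ.1 ^ (-(1:ℝ)/2) * τ.2.1 * τ.2.2 ^ (-(1:ℝ)/p) = w},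
    legendre3 (Phi p) τ

/-- `Λ_p(t₁,t₂) = log ∫ exp(t₁ y + t₂|y|^p) μ_p(dy)`. -/
def LamP (p : ℝ) (t : ℝ × ℝ) : EReal :=
  ENNReal.log (∫⁻ y, ENNReal.ofReal (Real.exp (t.1 * y + t.2 * |y| ^ p)) ∂(muP p))

/-- `Ψ_{p,ν}(t₁,t₂) = ∫ Λ_p(t₁ u, t₂) ν(du)`. -/
def Psi (p : ℝ) (ν : Measure ℝ) (t : ℝ × ℝ) : EReal :=
  eIntegral ν (fun u => LamP p (t.1 * u, t.2))

/-- The quenched rate function `𝕀^q_{p,ν}`. -/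
def Iq (p : ℝ) (ν : Measure ℝ) (w : ℝ) : EReal :=
  ⨅ τ ∈ {τ : ℝ × ℝ | 0 < τ.2 ∧ τ.1 * τ.2 ^ (-(1:ℝ)/p) = w}, legendre2 (Psi p ν) τ

/-- The Cramér-type rate function `𝕀^{cr}_p`. -/
def Icr (p : ℝ) (w : ℝ) : EReal :=
  ⨅ τ ∈ {τ : ℝ × ℝ | 0 < τ.2 ∧ τ.1 * τ.2 ^ (-(1:ℝ)/p) = w}, legendre2 (LamP p) τ

/-- `Φ_γ(t₀,t₁) = log ∫∫ exp(t₀ z² + t₁ z x) μ₂(dz) γ(dx)`. -/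
def Phig (γ : Measure ℝ) (t : ℝ × ℝ) : EReal :=
  ENNReal.log (∫⁻ x, (∫⁻ z,
    ENNReal.ofReal (Real.exp (t.1 * z^2 + t.2 * z * x)) ∂(muP 2)) ∂γ)

/-- The annealed rate function `𝕀ᵃ_γ` for a product measure `γ^{⊗n}`. -/
def Iag (γ : Measure ℝ) (w : ℝ) : EReal :=
  ⨅ τ ∈ {τ : ℝ × ℝ | 0 < τ.1 ∧ τ.1 ^ (-(1:ℝ)/2) * τ.2 = w}, legendre2 (Phig γ) τ

/-- `Ψ_{γ,ν}(t) = ∫ log M_γ(t u) ν(du)`. -/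
def Psig (γ ν : Measure ℝ) (t : ℝ) : EReal := eIntegral ν (fun u => logM γ (t * u))

/-- The quenched rate function `𝕀^q_{γ,ν}` for a product measure. -/
def Iqg (γ ν : Measure ℝ) : ℝ → EReal := legendre1 (Psig γ ν)

/-- `Ψ_{∞,ν}`. -/
def PsiInf (ν : Measure ℝ) : ℝ → EReal := Psig muInf ν

/-- `𝕀^q_{∞,ν}`. -/
def IqInf (ν : Measure ℝ) : ℝ → EReal := legendre1 (PsiInf ν)

/-- `𝕀ᵃ_∞`. -/
def IaInf : ℝ → EReal := Iag muInf

/-- Euclidean inner product on `ℝⁿ`. -/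
def dotp {n : ℕ} (x y : Fin n → ℝ) : ℝ := ∑ i, x i * y i

/-- The unit ℓ^p ball of `ℝⁿ`. -/
def lpBall (n : ℕ) (p : ℝ) : Set (Fin n → ℝ) := {x | ∑ i, |x i| ^ p ≤ 1}

/-- The uniform probability measure on the unit ℓ^p ball. -/
def uniformLpBall (n : ℕ) (p : ℝ) : Measure (Fin n → ℝ) :=
  (volume (lpBall n p))⁻¹ • volume.restrict (lpBall n p)

/-- The unit Euclidean sphere in `ℝⁿ`. -/
def unitSphereSet (n : ℕ) : Set (Fin n → ℝ) := {x | ∑ i, (x i)^2 = 1}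

/-- `μ` is the (unique) rotation-invariant probability measure on the unit sphere `S^{n-1}`. -/
def IsUniformSphere {n : ℕ} (μ : Measure (Fin n → ℝ)) : Prop :=
  IsProbabilityMeasure μ ∧ μ (unitSphereSet n) = 1 ∧
    ∀ O : Matrix.orthogonalGroup (Fin n) ℝ,
      Measure.map (fun x => (O : Matrix (Fin n) (Fin n) ℝ).mulVec x) μ = μ

/-- A large deviation principle with speed `s` and rate function `I`. -/
def IsLDP {Ω : Type*} [MeasurableSpace Ω] (P : Measure Ω)
    (ξ : ℕ → Ω → ℝ) (s : ℕ → ℝ) (I : ℝ → EReal) : Prop :=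
  LowerSemicontinuous I ∧
    ∀ Γ : Set ℝ, MeasurableSet Γ →
      (-(⨅ x ∈ interior Γ, I x) ≤
        atTop.liminf fun n =>
          (((s n)⁻¹ : ℝ) : EReal) * ENNReal.log (P {ω | ξ n ω ∈ interior Γ})) ∧
      ((atTop.limsup fun n =>
          (((s n)⁻¹ : ℝ) : EReal) * ENNReal.log (P {ω | ξ n ω ∈ closure Γ})) ≤
        -(⨅ x ∈ closure Γ, I x))

/-- Goodness of a rate function: compact sublevel sets. -/
def HasCompactSublevels (I : ℝ → EReal) : Prop := ∀ c : ℝ, IsCompact {x | I x ≤ (c : EReal)}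

/-- Quasiconvexity: convex sublevel sets. -/
def QuasiconvexRate (I : ℝ → EReal) : Prop := ∀ c : EReal, Convex ℝ {x | I x ≤ c}

/-- Symmetry: `I(-w) = I(w)`. -/
def SymmetricRate (I : ℝ → EReal) : Prop := ∀ w : ℝ, I (-w) = I w

/-- Convexity of an extended-real-valued rate function. -/
def ConvexRate (I : ℝ → EReal) : Prop :=
  ∀ x y a b : ℝ, 0 ≤ a → 0 ≤ b → a + b = 1 →
    I (a * x + b * y) ≤ (a : EReal) * I x + (b : EReal) * I y

/-- Convexity on a set, for extended-real-valued functions. -/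
def ConvexOnE (s : Set ℝ) (g : ℝ → EReal) : Prop :=
  ∀ x ∈ s, ∀ y ∈ s, ∀ a b : ℝ, 0 ≤ a → 0 ≤ b → a + b = 1 →
    g (a * x + b * y) ≤ (a : EReal) * g x + (b : EReal) * g y

/-- Concavity on a set, for extended-real-valued functions. -/
def ConcaveOnE (s : Set ℝ) (g : ℝ → EReal) : Prop :=
  ∀ x ∈ s, ∀ y ∈ s, ∀ a b : ℝ, 0 ≤ a → 0 ≤ b → a + b = 1 →
    (a : EReal) * g x + (b : EReal) * g y ≤ g (a * x + b * y)

/-- Strict convexity, for extended-real-valued functions. -/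
def StrictConvexE (g : ℝ → EReal) : Prop :=
  ∀ x y : ℝ, x ≠ y → ∀ a b : ℝ, 0 < a → 0 < b → a + b = 1 →
    g (a * x + b * y) < (a : EReal) * g x + (b : EReal) * g y

/-- The property of agreeing with a real affine function on a set. -/
def AffineOnE (s : Set ℝ) (g : ℝ → EReal) : Prop :=
  ∃ m q : ℝ, ∀ t ∈ s, g t = ((m * t + q : ℝ) : EReal)

/-- Empirical measure `L_{n,θ} = (1/n) Σ δ_{√n θ_i}`. -/
def empMeas (n : ℕ) (θn : Fin n → ℝ) : Measure ℝ :=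
  ((n : ℝ≥0∞))⁻¹ • ∑ i : Fin n, Measure.dirac (Real.sqrt n * θn i)

end LDP

open LDP


namespace LDP

/-! ### Concentration of empirical averages of a product measure -/

lemma integrable_pow_of_memLp_four {α : Type*} [MeasurableSpace α] {μ : Measure α}
    [IsProbabilityMeasure μ] {f : α → ℝ} (hf : MemLp f 4 μ) {k : ℕ} (hk : k ≤ 4) :
    Integrable (fun x => f x ^ k) μ := by
  have h1 : MemLp f k μ := hf.mono_exponent (by exact_mod_cast hk)
  refine (h1.integrable_norm_pow').mono' (hf.aestronglyMeasurable.pow k) ?_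
  exact Eventually.of_forall fun x => by simp

lemma memLp_sum_pi {μ : Measure ℝ} [IsProbabilityMeasure μ] {f : ℝ → ℝ} {q : ℝ≥0∞}
    (hf : MemLp f q μ) (n : ℕ) :
    MemLp (fun y : Fin n → ℝ => ∑ i, f (y i)) q (Measure.pi fun _ => μ) :=
  memLp_finsetSum _ fun i _ => hf.comp_measurePreserving (measurePreserving_eval (fun _ => μ) i)

lemma integral_sum_pi {μ : Measure ℝ} [IsProbabilityMeasure μ] {f : ℝ → ℝ}
    (hf : Integrable f μ) (n : ℕ) :
    ∫ y : Fin n → ℝ, ∑ i, f (y i) ∂(Measure.pi fun _ => μ) = n * ∫ x, f x ∂μ := by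
  rw [integral_finsetSum]
  · have : ∀ i : Fin n, ∫ y : Fin n → ℝ, f (y i) ∂(Measure.pi fun _ => μ) = ∫ x, f x ∂μ :=
      fun i => by
        have h := measurePreserving_eval (fun _ : Fin n => μ) i
        rw [← h.map_eq, integral_map h.measurable.aemeasurable (by rw [h.map_eq]; exact hf.1),
          h.map_eq]
    simp [this]
  · intro i _
    exact (measurePreserving_eval (fun _ : Fin n => μ) i).integrable_comp_of_integrable hf

lemma integral_sum_pi_succ {μ : Measure ℝ} [IsProbabilityMeasure μ] {f : ℝ → ℝ} (n k : ℕ) :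
    ∫ y : Fin (n + 1) → ℝ, (∑ i, f (y i)) ^ k ∂(Measure.pi fun _ => μ) =
      ∫ z : ℝ × (Fin n → ℝ), (f z.1 + ∑ i, f (z.2 i)) ^ k ∂(μ.prod (Measure.pi fun _ => μ)) := by
  rw [← (measurePreserving_piFinSuccAbove (fun _ : Fin (n + 1) => μ) 0).integral_comp']
  refine integral_congr_ae (Eventually.of_forall fun y => ?_)
  simp [Fin.sum_univ_succ, MeasurableEquiv.piFinSuccAbove, Fin.insertNthEquiv, Fin.tail]

lemma integral_add_pow_prod {α β : Type*} [MeasurableSpace α] [MeasurableSpace β]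
    {μ : Measure α} {ν : Measure β} [IsProbabilityMeasure μ] [IsProbabilityMeasure ν]
    {f : α → ℝ} {g : β → ℝ} (hf : MemLp f 4 μ) (hg : MemLp g 4 ν) {k : ℕ} (hk : k ≤ 4) :
    ∫ z, (f z.1 + g z.2) ^ k ∂(μ.prod ν) = ∑ m ∈ Finset.range (k + 1),
      (∫ x, f x ^ m ∂μ) * (∫ y, g y ^ (k - m) ∂ν) * (k.choose m : ℝ) := by
  simp_rw [add_pow]
  rw [integral_finsetSum]
  · refine Finset.sum_congr rfl fun m _ => ?_
    rw [integral_mul_const, integral_prod_mul (fun x => f x ^ m) (fun y => g y ^ (k - m))]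
  · intro m hm
    have hm' : m ≤ k := Finset.mem_range_succ_iff.1 hm
    exact ((integrable_pow_of_memLp_four hf (by omega)).mul_prod
      (integrable_pow_of_memLp_four hg (by omega))).mul_const _

lemma integral_sum_pow_two_pi {μ : Measure ℝ} [IsProbabilityMeasure μ] {f : ℝ → ℝ}
    (hf : MemLp f 4 μ) (hf0 : ∫ x, f x ∂μ = 0) (n : ℕ) :
    ∫ y : Fin n → ℝ, (∑ i, f (y i)) ^ 2 ∂(Measure.pi fun _ => μ) = n * ∫ x, f x ^ 2 ∂μ := by
  induction n with
  | zero => simp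
  | succ n ih =>
    rw [integral_sum_pi_succ, integral_add_pow_prod hf (memLp_sum_pi hf n) (by norm_num)]
    simp only [Finset.sum_range_succ, Finset.sum_range_zero]
    norm_num [hf0, ih]
    ring

lemma integral_sum_pow_four_pi_le {μ : Measure ℝ} [IsProbabilityMeasure μ] {f : ℝ → ℝ}
    (hf : MemLp f 4 μ) (hf0 : ∫ x, f x ∂μ = 0) (n : ℕ) :
    ∫ y : Fin n → ℝ, (∑ i, f (y i)) ^ 4 ∂(Measure.pi fun _ => μ) ≤
      (∫ x, f x ^ 4 ∂μ + 3 * (∫ x, f x ^ 2 ∂μ) ^ 2) * (n : ℝ) ^ 2 := by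
  have hb : 0 ≤ ∫ x, f x ^ 4 ∂μ := integral_nonneg fun x => by positivity
  induction n with
  | zero => simp
  | succ n ih =>
    have h1 := integral_sum_pi (hf.integrable (by norm_num)) n
    rw [hf0, mul_zero] at h1
    rw [integral_sum_pi_succ, integral_add_pow_prod hf (memLp_sum_pi hf n) le_rfl]
    simp only [Finset.sum_range_succ, Finset.sum_range_zero]
    norm_num [hf0, h1, integral_sum_pow_two_pi hf hf0, Nat.choose]
    nlinarith [mul_nonneg hb (Nat.cast_nonneg (α := ℝ) n), sq_nonneg (∫ x, f x ^ 2 ∂μ)]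

/-- The empirical average of `f` over the coordinates of `u`. -/
def avg {n : ℕ} (f : ℝ → ℝ) (u : Fin n → ℝ) : ℝ := (n : ℝ)⁻¹ * ∑ i, f (u i)

lemma measure_avg_deviation_le {μ : Measure ℝ} [IsProbabilityMeasure μ] {f : ℝ → ℝ}
    (hf : MemLp f 4 μ) {ε : ℝ} (hε : 0 < ε) :
    ∃ C : ℝ, 0 ≤ C ∧ ∀ n : ℕ, 0 < n → (Measure.pi fun _ : Fin n => μ)
      {y | ε ≤ |avg f y - ∫ x, f x ∂μ|} ≤ ENNReal.ofReal (C / (n : ℝ) ^ 2) := by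
  set m := ∫ x, f x ∂μ
  set g : ℝ → ℝ := fun x => f x - m
  have hg : MemLp g 4 μ := hf.sub (memLp_const m)
  have hfi : Integrable f μ := hf.integrable (by norm_num)
  have hg0 : ∫ x, g x ∂μ = 0 := by
    simp [g, integral_sub hfi (integrable_const m), m]
  set D := ∫ x, g x ^ 4 ∂μ + 3 * (∫ x, g x ^ 2 ∂μ) ^ 2
  have hD : 0 ≤ D := add_nonneg (integral_nonneg fun x => by positivity) (by positivity)
  refine ⟨D / ε ^ 4, by positivity, fun n hn => ?_⟩
  have hn' : (0 : ℝ) < n := by exact_mod_cast hn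
  have hsub : {y : Fin n → ℝ | ε ≤ |avg f y - m|} ⊆
      {y | (n * ε) ^ 4 ≤ (∑ i, g (y i)) ^ 4} := by
    intro y hy
    simp only [mem_ofPred_eq] at hy ⊢
    have e : ∑ i, g (y i) = n * (avg f y - m) := by
      simp only [g, avg, Finset.sum_sub_distrib, Finset.sum_const, Finset.card_univ,
        Fintype.card_fin, nsmul_eq_mul]
      field_simp
    rw [e, mul_pow, mul_pow, ← (show Even 4 by decide).pow_abs (avg f y - m)]
    gcongr
  have hint := integrable_pow_of_memLp_four (memLp_sum_pi hg n) (le_refl 4)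
  have hM := mul_meas_ge_le_integral_of_nonneg
    (Eventually.of_forall fun y : Fin n → ℝ => by positivity) hint ((n * ε) ^ 4)
  refine (measure_mono hsub).trans ?_
  rw [← ofReal_measureReal]
  refine ENNReal.ofReal_le_ofReal ?_
  rw [div_div, le_div_iff₀ (by positivity)]
  have := hM.trans (integral_sum_pow_four_pi_le hg hg0 n)
  set q := (Measure.pi fun _ : Fin n => μ).real {y | (n * ε) ^ 4 ≤ (∑ i, g (y i)) ^ 4}
  have h2 : (n : ℝ) ^ 2 * (q * (ε ^ 4 * n ^ 2)) ≤ (n : ℝ) ^ 2 * D := by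
    calc _ = (n * ε) ^ 4 * q := by ring
      _ ≤ D * n ^ 2 := this
      _ = _ := by ring
  exact le_of_mul_le_mul_left h2 (by positivity)

/-! ### The uniform measure on the sphere as a normalized Gaussian vector -/

section Uniqueness

variable {E : Type*} [NormedAddCommGroup E] [InnerProductSpace ℝ E] [FiniteDimensional ℝ E]
  [MeasurableSpace E] [BorelSpace E]

lemma charFun_eq_of_norm_eq {ν : Measure E} (h : ∀ O : E ≃ₗᵢ[ℝ] E, ν.map O = ν) {ξ η : E}
    (hn : ‖ξ‖ = ‖η‖) : charFun ν ξ = charFun ν η := by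
  set O : E ≃ₗᵢ[ℝ] E := (ℝ ∙ (ξ - η))ᗮ.reflection
  have hO : O ξ = η := Submodule.reflection_sub hn
  conv_rhs => rw [← h O, ← hO]
  rw [charFun_apply, charFun_apply, integral_map O.continuous.measurable.aemeasurable
    (by fun_prop)]
  simp

lemma eq_of_rotation_invariant {ν₁ ν₂ : Measure E} [IsProbabilityMeasure ν₁]
    [IsProbabilityMeasure ν₂] (h₁ : ∀ O : E ≃ₗᵢ[ℝ] E, ν₁.map O = ν₁)
    (h₂ : ∀ O : E ≃ₗᵢ[ℝ] E, ν₂.map O = ν₂) (hs₁ : ∀ᵐ x ∂ν₁, ‖x‖ = 1)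
    (hs₂ : ∀ᵐ x ∂ν₂, ‖x‖ = 1) : ν₁ = ν₂ := by
  have key : ∀ {μ ν : Measure E} [IsProbabilityMeasure ν],
      (∀ O : E ≃ₗᵢ[ℝ] E, μ.map O = μ) → (∀ᵐ x ∂ν, ‖x‖ = 1) → ∀ ξ : E,
      charFun μ ξ = ∫ y, ∫ x, Complex.exp (inner ℝ x (‖ξ‖ • y) * Complex.I) ∂μ ∂ν := by
    intro μ ν _ h hs ξ
    have : ∀ᵐ y ∂ν, ∫ x, Complex.exp (inner ℝ x (‖ξ‖ • y) * Complex.I) ∂μ = charFun μ ξ := by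
      filter_upwards [hs] with y hy
      rw [← charFun_apply]
      exact charFun_eq_of_norm_eq h (by rw [norm_smul, hy]; simp)
    rw [integral_congr_ae this]
    simp
  refine Measure.ext_of_charFun (funext fun ξ => ?_)
  rw [key (ν := ν₂) h₁ hs₂ ξ, key (ν := ν₁) h₂ hs₁ ξ, integral_integral_swap]
  · simp only [real_inner_smul_right, real_inner_comm]
  · refine (integrable_const (1 : ℝ)).mono' (by fun_prop) (Eventually.of_forall fun z => ?_)
    simp [Function.uncurry, Complex.norm_exp]

end Uniqueness

lemma exists_orthogonal_of_isometry {n : ℕ}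
    (O : EuclideanSpace ℝ (Fin n) ≃ₗᵢ[ℝ] EuclideanSpace ℝ (Fin n)) :
    ∃ M : Matrix.orthogonalGroup (Fin n) ℝ, ∀ x : Fin n → ℝ,
      O (WithLp.toLp 2 x) = WithLp.toLp 2 ((M : Matrix (Fin n) (Fin n) ℝ).mulVec x) := by
  set M : Matrix (Fin n) (Fin n) ℝ :=
    Matrix.of fun i j => O (EuclideanSpace.single j 1) i
  have hM : ∀ x : Fin n → ℝ, O (WithLp.toLp 2 x) = WithLp.toLp 2 (M.mulVec x) := by
    intro x
    have hx : WithLp.toLp 2 x = ∑ j, x j • EuclideanSpace.single j (1 : ℝ) := by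
      ext i
      simp [Finset.sum_apply, Pi.single_apply]
    rw [hx, map_sum]
    ext i
    simp [M, Matrix.mulVec, dotProduct, mul_comm]
  refine ⟨⟨M, (Matrix.mem_orthogonalGroup_iff' (Fin n) ℝ).2 ?_⟩, hM⟩
  ext i j
  have h := O.inner_map_map (EuclideanSpace.single i (1 : ℝ)) (EuclideanSpace.single j 1)
  rw [PiLp.inner_apply] at h
  simp only [EuclideanSpace.inner_single_left] at h
  simpa [Matrix.mul_apply, M, Matrix.one_apply, mul_comm, Pi.single_apply, eq_comm] using h

lemma uniformSphere_eq_map_gaussian {n : ℕ} (hn : 0 < n) {μ : Measure (Fin n → ℝ)}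
    (h : IsUniformSphere μ) :
    μ = (Measure.pi fun _ => gaussianReal 0 1).map
      (fun y i => y i / √(∑ j, y j ^ 2)) := by
  obtain ⟨hμ, hs, hO⟩ := h
  have hmE : Measurable (WithLp.toLp 2 : (Fin n → ℝ) → EuclideanSpace ℝ (Fin n)) := by fun_prop
  have hmF : Measurable (WithLp.ofLp : EuclideanSpace ℝ (Fin n) → (Fin n → ℝ)) := by fun_prop
  have hN : Measurable (fun y : EuclideanSpace ℝ (Fin n) => ‖y‖⁻¹ • y) := by fun_prop
  set ν₁ := μ.map (WithLp.toLp 2 : _ → EuclideanSpace ℝ (Fin n))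
  set ν₂ := (stdGaussian (EuclideanSpace ℝ (Fin n))).map (fun y => ‖y‖⁻¹ • y)
  have : IsProbabilityMeasure ν₁ := Measure.isProbabilityMeasure_map hmE.aemeasurable
  have : IsProbabilityMeasure ν₂ := Measure.isProbabilityMeasure_map hN.aemeasurable
  have e : ν₁ = ν₂ := by
    refine eq_of_rotation_invariant ?_ ?_ ?_ ?_
    · intro O
      obtain ⟨M, hM⟩ := exists_orthogonal_of_isometry O
      have hMm : Measurable fun x : Fin n → ℝ => (M : Matrix (Fin n) (Fin n) ℝ).mulVec x :=
        (Continuous.matrix_mulVec continuous_const continuous_id).measurable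
      rw [Measure.map_map O.continuous.measurable hmE]
      have : (⇑O ∘ WithLp.toLp 2 : (Fin n → ℝ) → _) = WithLp.toLp 2 ∘
          fun x : Fin n → ℝ => (M : Matrix (Fin n) (Fin n) ℝ).mulVec x := funext hM
      rw [this, ← Measure.map_map hmE hMm, hO]
    · intro O
      rw [Measure.map_map O.continuous.measurable hN]
      have : (⇑O ∘ fun y : EuclideanSpace ℝ (Fin n) => ‖y‖⁻¹ • y) =
          (fun y => ‖y‖⁻¹ • y) ∘ ⇑O := by
        ext y
        simp
      rw [this, ← Measure.map_map hN O.continuous.measurable, stdGaussian_map]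
    · refine (ae_map_iff hmE.aemeasurable
        (measurableSet_eq_fun measurable_norm measurable_const)).2 ?_
      have h1 : ∀ᵐ x ∂μ, x ∈ unitSphereSet n := by
        refine (prob_compl_eq_zero_iff ?_).2 hs
        exact measurableSet_eq_fun (by fun_prop) measurable_const
      filter_upwards [h1] with x hx
      have : ∑ i, x i ^ 2 = 1 := hx
      simp [EuclideanSpace.norm_eq, this]
    · refine (ae_map_iff hN.aemeasurable
        (measurableSet_eq_fun measurable_norm measurable_const)).2 ?_
      have : Nonempty (Fin n) := ⟨⟨0, hn⟩⟩
      have := nullSingletonClass_gaussianReal (μ := 0) (v := 1) one_ne_zero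
      have h0 : ∀ᵐ y : EuclideanSpace ℝ (Fin n) ∂(stdGaussian (EuclideanSpace ℝ (Fin n))),
          y ≠ 0 := by
        rw [← map_pi_eq_stdGaussian]
        refine (ae_map_iff hmE.aemeasurable (measurableSet_singleton _).compl).2 ?_
        have : ∀ᵐ y : Fin n → ℝ ∂(Measure.pi fun _ => gaussianReal 0 1), y ≠ 0 := by
          exact compl_mem_ae_iff.2 (measure_singleton (0 : Fin n → ℝ))
        filter_upwards [this] with y hy
        simpa using hy
      filter_upwards [h0] with y hy
      rw [norm_smul, norm_inv, norm_norm, inv_mul_cancel₀ (norm_ne_zero_iff.2 hy)]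
  have e2 : μ = ν₁.map WithLp.ofLp := by
    rw [Measure.map_map hmF hmE]
    exact Measure.map_id.symm
  rw [e2, e]
  simp only [ν₂]
  rw [← map_pi_eq_stdGaussian, Measure.map_map hN hmE, Measure.map_map hmF (hN.comp hmE)]
  congr 1
  ext y i
  simp [EuclideanSpace.norm_eq, div_eq_inv_mul]

/-! ### Empirical averages along almost every sequence of directions -/

/-- Truncation of a real number to `[-R, R]`. -/
def clamp (R x : ℝ) : ℝ := max (-R) (min R x)

lemma continuous_clamp (R : ℝ) : Continuous (clamp R) := by
  unfold clamp; fun_prop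

lemma abs_clamp_le {R : ℝ} (hR : 0 ≤ R) (x : ℝ) : |clamp R x| ≤ R := by
  unfold clamp
  exact abs_le.2 ⟨le_max_left _ _, max_le (by linarith) (min_le_left _ _)⟩

lemma abs_clamp_sub_le (R x y : ℝ) : |clamp R x - clamp R y| ≤ |x - y| := by
  unfold clamp
  rw [max_comm (-R), max_comm (-R), min_comm R, min_comm R]
  refine (abs_max_sub_max_le_abs _ _ _).trans ?_
  refine (abs_min_sub_min_le_max x R y R).trans ?_
  simp

lemma clamp_eq_self {R x : ℝ} (h : |x| ≤ R) : clamp R x = x := by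
  unfold clamp
  rw [min_eq_right (abs_le.1 h).2, max_eq_right (abs_le.1 h).1]

lemma clamp_pow_lipschitz {R : ℝ} (hR : 0 ≤ R) (k : ℕ) :
    ∃ L : ℝ, 0 ≤ L ∧ ∀ x y, |clamp R x ^ k - clamp R y ^ k| ≤ L * |x - y| := by
  refine ⟨k * R ^ (k - 1), by positivity, fun x y => ?_⟩
  calc _ ≤ |clamp R x - clamp R y| * k * max |clamp R x| |clamp R y| ^ (k - 1) :=
        abs_pow_sub_pow_le _ _ _
    _ ≤ |x - y| * k * R ^ (k - 1) := by
        have h1 := abs_clamp_sub_le R x y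
        have h2 := max_le (abs_clamp_le hR x) (abs_clamp_le hR y)
        have h3 : 0 ≤ max |clamp R x| |clamp R y| := le_max_of_le_left (abs_nonneg _)
        have h4 : 0 ≤ |x - y| := abs_nonneg _
        generalize |clamp R x - clamp R y| = a at *
        generalize max |clamp R x| |clamp R y| = b at *
        generalize |x - y| = c at *
        gcongr
    _ = _ := by ring

lemma avg_nonneg {n : ℕ} {f : ℝ → ℝ} (hf : ∀ x, 0 ≤ f x) (u : Fin n → ℝ) : 0 ≤ avg f u :=
  mul_nonneg (by positivity) (Finset.sum_nonneg fun _ _ => hf _)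

lemma avg_mono {n : ℕ} {f g : ℝ → ℝ} (h : ∀ x, f x ≤ g x) (u : Fin n → ℝ) :
    avg f u ≤ avg g u :=
  mul_le_mul_of_nonneg_left (Finset.sum_le_sum fun _ _ => h _) (by positivity)

lemma avg_add {n : ℕ} (f g : ℝ → ℝ) (u : Fin n → ℝ) :
    avg (fun x => f x + g x) u = avg f u + avg g u := by
  simp [avg, Finset.sum_add_distrib, mul_add]

lemma avg_sub {n : ℕ} (f g : ℝ → ℝ) (u : Fin n → ℝ) :
    avg (fun x => f x - g x) u = avg f u - avg g u := by
  simp [avg, Finset.sum_sub_distrib, mul_sub]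

lemma avg_const_mul {n : ℕ} (c : ℝ) (f : ℝ → ℝ) (u : Fin n → ℝ) :
    avg (fun x => c * f x) u = c * avg f u := by
  simp only [avg, ← Finset.mul_sum]; ring

lemma avg_const {n : ℕ} (hn : 0 < n) (c : ℝ) (u : Fin n → ℝ) : avg (fun _ => c) u = c := by
  have : (n : ℝ) ≠ 0 := by positivity
  simp [avg]
  field_simp

lemma abs_avg_le {n : ℕ} (f : ℝ → ℝ) (u : Fin n → ℝ) : |avg f u| ≤ avg (fun x => |f x|) u := by
  unfold avg
  rw [abs_mul, abs_of_nonneg (by positivity : (0 : ℝ) ≤ (n : ℝ)⁻¹)]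
  exact mul_le_mul_of_nonneg_left (Finset.abs_sum_le_sum_abs _ _) (by positivity)

lemma measurable_avg {n : ℕ} {f : ℝ → ℝ} (hf : Measurable f) :
    Measurable (fun u : Fin n → ℝ => avg f u) := by
  unfold avg; fun_prop

lemma avg_abs_le_sqrt {n : ℕ} (y : Fin n → ℝ) :
    avg (fun x => |x|) y ≤ √(avg (fun x => x ^ 2) y) := by
  refine Real.le_sqrt_of_sq_le ?_
  have h := sq_sum_le_card_mul_sum_sq (s := Finset.univ) (f := fun i => |y i|)
  simp only [Finset.card_univ, Fintype.card_fin, sq_abs] at h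
  rcases Nat.eq_zero_or_pos n with rfl | hn
  · simp [avg]
  have hn' : (0 : ℝ) < n := by exact_mod_cast hn
  unfold avg
  rw [mul_pow]
  calc _ ≤ ((n : ℝ)⁻¹) ^ 2 * (n * ∑ i, y i ^ 2) := by gcongr
    _ = _ := by field_simp

lemma normalized_eq {n : ℕ} (hn : 0 < n) (y : Fin n → ℝ) (i : Fin n) :
    √n * (y i / √(∑ j, y j ^ 2)) = y i / √(avg (fun x => x ^ 2) y) := by
  have hn' : (0 : ℝ) < n := by exact_mod_cast hn
  unfold avg
  rw [Real.sqrt_mul (by positivity), Real.sqrt_inv]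
  have := Real.sqrt_pos.2 hn'
  rcases eq_or_ne (√(∑ j, y j ^ 2)) 0 with h | h
  · simp [h]
  · field_simp

lemma abs_avg_normalized_sub_le {n : ℕ} {h : ℝ → ℝ} {L : ℝ} (hL : 0 ≤ L)
    (hh : ∀ x y, |h x - h y| ≤ L * |x - y|) (y : Fin n → ℝ)
    (hq : 0 < avg (fun x => x ^ 2) y) :
    |avg h (fun i => y i / √(avg (fun x => x ^ 2) y)) - avg h y| ≤
      L * |avg (fun x => x ^ 2) y - 1| := by
  set q := avg (fun x => x ^ 2) y
  set r := √q
  have hr : 0 < r := Real.sqrt_pos.2 hq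
  have hrq : q = r ^ 2 := (Real.sq_sqrt hq.le).symm
  have e : avg h (fun i => y i / r) - avg h y = avg (fun x => h (x / r) - h x) y := by
    rw [avg_sub]; rfl
  rw [e]
  calc _ ≤ avg (fun x => |h (x / r) - h x|) y := abs_avg_le _ _
    _ ≤ avg (fun x => (L * |1 / r - 1|) * |x|) y := by
        refine avg_mono (fun x => (hh _ _).trans (le_of_eq ?_)) y
        rw [mul_assoc, ← abs_mul]
        congr 2
        ring
    _ = (L * |1 / r - 1|) * avg (fun x => |x|) y := avg_const_mul _ _ _
    _ ≤ (L * |1 / r - 1|) * r := by gcongr; exact avg_abs_le_sqrt y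
    _ = L * |1 - r| := by
        rw [mul_assoc, ← abs_of_pos hr, ← abs_mul, abs_of_pos hr]
        congr 2
        field_simp
    _ ≤ L * |q - 1| := by
        refine mul_le_mul_of_nonneg_left ?_ hL
        rw [hrq, show r ^ 2 - 1 = (r + 1) * (r - 1) by ring, abs_mul, abs_sub_comm]
        rw [abs_of_pos (by linarith : 0 < r + 1)]
        nlinarith [abs_nonneg (r - 1)]

lemma ae_eventually_scaled_notMem {σ : Measure ((n : ℕ) → Fin n → ℝ)}
    (hσ : ∀ n, 0 < n → IsUniformSphere (Measure.map (fun θ => θ n) σ))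
    {B : ∀ n, Set (Fin n → ℝ)} (hB : ∀ n, MeasurableSet (B n)) {C : ℝ}
    (h : ∀ n : ℕ, 0 < n → (Measure.pi fun _ : Fin n => gaussianReal 0 1)
      {y | (fun i => y i / √(avg (fun x => x ^ 2) y)) ∈ B n} ≤ ENNReal.ofReal (C / (n : ℝ) ^ 2)) :
    ∀ᵐ θ ∂σ, ∀ᶠ n : ℕ in atTop, (fun i => √n * θ n i) ∉ B n := by
  have hs : Summable fun n : ℕ => C / (n : ℝ) ^ 2 := by
    simpa [div_eq_mul_inv] using (Real.summable_one_div_nat_pow.2 one_lt_two).mul_left C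
  have key := ae_eventually_notMem (μ := σ)
    (s := fun n => {θ | 0 < n ∧ (fun i => √n * θ n i) ∈ B n}) (ne_top_of_le_ne_top
      hs.tsum_ofReal_ne_top (ENNReal.tsum_le_tsum fun n => ?_))
  · filter_upwards [key] with θ hθ
    filter_upwards [hθ, eventually_gt_atTop 0] with n hn hpos hmem
    exact hn ⟨hpos, hmem⟩
  · rcases Nat.eq_zero_or_pos n with rfl | hn
    · simp
    refine le_trans (le_of_eq ?_) (h n hn)
    have hm : Measurable fun x : Fin n → ℝ => fun i => √n * x i := by fun_prop
    have hN : Measurable fun y : Fin n → ℝ => fun i => y i / √(∑ j, y j ^ 2) := by fun_prop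
    have e1 : {θ : (n : ℕ) → Fin n → ℝ | 0 < n ∧ (fun i => √n * θ n i) ∈ B n} =
        (fun θ => θ n) ⁻¹' ((fun x i => √n * x i) ⁻¹' B n) := by
      ext θ; simp [hn]
    rw [e1, ← Measure.map_apply (measurable_pi_apply n) (hm (hB n)),
      uniformSphere_eq_map_gaussian hn (hσ n hn), Measure.map_apply hN (hm (hB n))]
    congr 1
    ext y
    simp only [mem_preimage, mem_ofPred_eq, normalized_eq hn]

lemma memLp_four_gaussian_pow (k : ℕ) : MemLp (fun x : ℝ => x ^ k) 4 (gaussianReal 0 1) := by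
  have h := (memLp_id_gaussianReal' (μ := 0) (v := 1) ((4 * k : ℕ) : ℝ≥0∞)
    (ENNReal.natCast_ne_top _)).integrable_norm_pow'
  refine (integrable_norm_rpow_iff (by fun_prop) (by norm_num) (by norm_num)).1 ?_
  refine h.congr (Eventually.of_forall fun x => ?_)
  have : (4 : ℝ≥0∞).toReal = ((4 : ℕ) : ℝ) := by norm_num
  simp only [id, this, Real.rpow_natCast, norm_pow, ← pow_mul]
  ring_nf

/-- Arrays whose empirical distributions approach the standard Gaussian law, with bounded
moments. -/
structure GoodArray (u : (n : ℕ) → Fin n → ℝ) : Prop where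
  tendsto_clamp : ∀ R k : ℕ, Tendsto (fun n => avg (fun x => clamp R x ^ k) (u n)) atTop
    (𝓝 (∫ x, clamp R x ^ k ∂(gaussianReal 0 1)))
  moment_bound : ∀ K : ℕ, ∃ C : ℝ, ∀ᶠ n in atTop, avg (fun x => x ^ (2 * K)) (u n) ≤ C

lemma ae_goodArray {σ : Measure ((n : ℕ) → Fin n → ℝ)}
    (hσ : ∀ n, 0 < n → IsUniformSphere (Measure.map (fun θ => θ n) σ)) :
    ∀ᵐ θ ∂σ, GoodArray (fun n i => √n * θ n i) := by
  set γ := gaussianReal 0 1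
  have hq1 : ∫ x : ℝ, x ^ 2 ∂γ = 1 := by
    have := variance_id_gaussianReal (μ := 0) (v := 1)
    rw [variance_eq_integral (by fun_prop)] at this
    simpa using this
  have h2 : MemLp (fun x : ℝ => x ^ 2) 4 γ := memLp_four_gaussian_pow 2
  have hA : ∀ R k m : ℕ, ∀ᵐ θ ∂σ, ∀ᶠ n : ℕ in atTop, (fun i => √n * θ n i) ∉
      {v : Fin n → ℝ | 1 / ((m : ℝ) + 1) ≤
        |avg (fun x => clamp R x ^ k) v - ∫ x, clamp R x ^ k ∂γ|} := by
    intro R k m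
    set h : ℝ → ℝ := fun x => clamp R x ^ k
    have hR : (0 : ℝ) ≤ R := by positivity
    have hc : Continuous h := (continuous_clamp _).pow k
    have hh : MemLp h 4 γ := MemLp.of_bound hc.aestronglyMeasurable ((R : ℝ) ^ k)
      (Eventually.of_forall fun x => by
        simp only [h, norm_pow, Real.norm_eq_abs]
        exact pow_le_pow_left₀ (abs_nonneg _) (abs_clamp_le hR x) k)
    obtain ⟨L, hL, hLip⟩ := clamp_pow_lipschitz hR k
    set ε : ℝ := 1 / ((m : ℝ) + 1)
    have hε : 0 < ε := by positivity
    set δ : ℝ := min (1 / 2) (ε / (2 * (L + 1)))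
    have hδ : 0 < δ := by positivity
    obtain ⟨C₁, hC₁, hb₁⟩ := measure_avg_deviation_le hh (half_pos hε)
    obtain ⟨C₂, hC₂, hb₂⟩ := measure_avg_deviation_le h2 hδ
    refine ae_eventually_scaled_notMem hσ (C := C₁ + C₂) (fun n => ?_) (fun n hn => ?_)
    · exact measurableSet_le measurable_const
        (((measurable_avg hc.measurable).sub measurable_const).abs)
    rw [add_div, ENNReal.ofReal_add (by positivity) (by positivity)]
    refine le_trans (le_trans (measure_mono ?_) (measure_union_le _ _))
      (add_le_add (hb₁ n hn) (hb₂ n hn))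
    intro y hy
    by_contra hcon
    simp only [mem_union, mem_ofPred_eq, not_or, not_le, hq1] at hcon hy
    obtain ⟨hc1, hc2⟩ := hcon
    have hq : 0 < avg (fun x => x ^ 2) y := by
      have := (abs_lt.1 (hc2.trans_le (min_le_left _ _))).1
      linarith
    have h3 := abs_avg_normalized_sub_le hL hLip y hq
    have h4 : L * |avg (fun x => x ^ 2) y - 1| ≤ ε / 2 := by
      calc _ ≤ (L + 1) * (ε / (2 * (L + 1))) := by
            gcongr
            · linarith
            · exact (hc2.trans_le (min_le_right _ _)).le
        _ = ε / 2 := by field_simp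
    have h5 := abs_sub_le (avg h (fun i => y i / √(avg (fun x => x ^ 2) y))) (avg h y)
      (∫ x, h x ∂γ)
    linarith
  have hM : ∀ K : ℕ, ∃ M : ℝ, ∀ᵐ θ ∂σ, ∀ᶠ n : ℕ in atTop, (fun i => √n * θ n i) ∉
      {v : Fin n → ℝ | M ≤ avg (fun x => x ^ (2 * K)) v} := by
    intro K
    set mK := ∫ x : ℝ, x ^ (2 * K) ∂γ
    obtain ⟨C₁, hC₁, hb₁⟩ := measure_avg_deviation_le (memLp_four_gaussian_pow (2 * K)) one_pos
    obtain ⟨C₂, hC₂, hb₂⟩ := measure_avg_deviation_le h2 (half_pos one_pos)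
    refine ⟨2 ^ K * (mK + 1), ae_eventually_scaled_notMem hσ (C := C₁ + C₂) (fun n => ?_)
      (fun n hn => ?_)⟩
    · exact measurableSet_le measurable_const (measurable_avg (by fun_prop))
    rw [add_div, ENNReal.ofReal_add (by positivity) (by positivity)]
    refine le_trans (le_trans (measure_mono ?_) (measure_union_le _ _))
      (add_le_add (hb₁ n hn) (hb₂ n hn))
    intro y hy
    by_contra hcon
    simp only [mem_union, mem_ofPred_eq, not_or, not_le, hq1] at hcon hy
    obtain ⟨hc1, hc2⟩ := hcon
    set q := avg (fun x => x ^ 2) y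
    have hq : 1 / 2 < q := by linarith [(abs_lt.1 hc2).1]
    have e : avg (fun x => x ^ (2 * K)) (fun i => y i / √q) =
        (q ^ K)⁻¹ * avg (fun x => x ^ (2 * K)) y := by
      rw [← avg_const_mul]
      unfold avg
      congr 1
      refine Finset.sum_congr rfl fun i _ => ?_
      show (y i / √q) ^ (2 * K) = (q ^ K)⁻¹ * y i ^ (2 * K)
      rw [div_pow, pow_mul (√q), Real.sq_sqrt (by linarith)]
      ring
    rw [e] at hy
    have h1 : avg (fun x => x ^ (2 * K)) y < mK + 1 := by
      have := (abs_lt.1 hc1).2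
      linarith
    have h0 : 0 ≤ avg (fun x => x ^ (2 * K)) y :=
      avg_nonneg (fun x => (even_two_mul K).pow_nonneg x) y
    have h3 : (q ^ K)⁻¹ ≤ 2 ^ K := by
      rw [← inv_pow]
      refine pow_le_pow_left₀ (by positivity) ?_ K
      rw [inv_le_comm₀ (by linarith) two_pos]
      linarith
    have h4 : (q ^ K)⁻¹ * avg (fun x => x ^ (2 * K)) y < 2 ^ K * (mK + 1) :=
      mul_lt_mul' h3 h1 h0 (by positivity)
    linarith
  choose M hM using hM
  filter_upwards [ae_all_iff.2 fun R => ae_all_iff.2 fun k => ae_all_iff.2 (hA R k),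
    ae_all_iff.2 hM] with θ h₁ h₂
  refine ⟨fun R k => Metric.tendsto_atTop'.2 fun ε hε => ?_, fun K => ⟨M K, ?_⟩⟩
  · obtain ⟨m, hm⟩ := exists_nat_one_div_lt hε
    obtain ⟨N, hN⟩ := eventually_atTop.1 (h₁ R k m)
    refine ⟨N, fun n hn => ?_⟩
    have := hN n hn.le
    simp only [not_le] at this
    rw [Real.dist_eq]
    exact this.trans hm
  · filter_upwards [h₂ K] with n hn
    simp only [not_le] at hn
    exact hn.le

lemma tendsto_of_approx {x : ℕ → ℝ} {l : ℝ}
    (h : ∀ ε > 0, ∃ (a : ℕ → ℝ) (b : ℝ), Tendsto a atTop (𝓝 b) ∧ (∀ᶠ n in atTop, |x n - a n| ≤ ε) ∧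
      |l - b| ≤ ε) : Tendsto x atTop (𝓝 l) := by
  refine Metric.tendsto_nhds.2 fun ε hε => ?_
  obtain ⟨a, b, hab, hx, hl⟩ := h (ε / 4) (by positivity)
  filter_upwards [Metric.tendsto_nhds.1 hab (ε / 4) (by positivity), hx] with n h1 h2
  rw [Real.dist_eq] at *
  have h3 := abs_sub_le (x n) (a n) b
  have h4 := abs_sub_le (x n) b l
  rw [abs_sub_comm b l] at h4
  linarith

lemma abs_clamp_le_abs {R : ℝ} (hR : 0 ≤ R) (x : ℝ) : |clamp R x| ≤ |x| := by
  have h0 : clamp R 0 = 0 := clamp_eq_self (by simpa using hR)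
  simpa [h0] using abs_clamp_sub_le R x 0

lemma avg_finsetSum {n : ℕ} {ι : Type*} (s : Finset ι) (f : ι → ℝ → ℝ) (u : Fin n → ℝ) :
    avg (fun x => ∑ j ∈ s, f j x) u = ∑ j ∈ s, avg (f j) u := by
  simp only [avg]
  rw [Finset.sum_comm, Finset.mul_sum]

lemma integrable_pow_gaussian (k : ℕ) : Integrable (fun x : ℝ => x ^ k) (gaussianReal 0 1) :=
  (memLp_four_gaussian_pow k).integrable (by norm_num)

lemma integrable_gaussian_of_growth {f : ℝ → ℝ} (hf : Continuous f) {C : ℝ} {K : ℕ}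
    (hb : ∀ x, |f x| ≤ C * (1 + x ^ (2 * K))) : Integrable f (gaussianReal 0 1) :=
  Integrable.mono' (((integrable_const 1).add (integrable_pow_gaussian (2 * K))).const_mul C)
    hf.aestronglyMeasurable (Eventually.of_forall hb)

lemma GoodArray.tendsto_avg_clamp {u : (n : ℕ) → Fin n → ℝ} (hu : GoodArray u) {f : ℝ → ℝ}
    (hf : Continuous f) (R : ℕ) :
    Tendsto (fun n => avg (fun x => f (clamp R x)) (u n)) atTop
      (𝓝 (∫ x, f (clamp R x) ∂(gaussianReal 0 1))) := by
  refine tendsto_of_approx fun ε hε => ?_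
  have hR : (0 : ℝ) ≤ R := by positivity
  obtain ⟨P, hP⟩ := exists_polynomial_near_of_continuousOn (-R : ℝ) R f hf.continuousOn ε hε
  have hPc : ∀ x, |f (clamp R x) - P.eval (clamp R x)| ≤ ε := fun x => by
    rw [abs_sub_comm]
    exact (hP _ (abs_le.1 (abs_clamp_le hR x))).le
  have hint : ∀ {g : ℝ → ℝ}, Continuous g →
      Integrable (fun x => g (clamp R x)) (gaussianReal 0 1) := fun {g} hg => by
    obtain ⟨M, hM⟩ := (isCompact_Icc (a := (-R : ℝ)) (b := R)).exists_bound_of_continuousOn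
      hg.continuousOn
    exact Integrable.of_bound (hg.comp (continuous_clamp _)).aestronglyMeasurable M
      (Eventually.of_forall fun x => hM _ (abs_le.1 (abs_clamp_le hR x)))
  refine ⟨fun n => avg (fun x => P.eval (clamp R x)) (u n),
    ∫ x, P.eval (clamp R x) ∂(gaussianReal 0 1), ?_, ?_, ?_⟩
  · simp only [Polynomial.eval_eq_sum_range, avg_finsetSum, avg_const_mul]
    rw [integral_finsetSum _ fun i _ => (hint (continuous_pow i)).const_mul _]
    simp only [integral_const_mul]
    exact tendsto_finsetSum _ fun i _ => (hu.tendsto_clamp R i).const_mul _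
  · filter_upwards [eventually_gt_atTop 0] with n hn
    rw [← avg_sub, ← avg_const hn ε (u n)]
    exact (abs_avg_le _ _).trans (avg_mono hPc _)
  · rw [← integral_sub (hint hf) (hint P.continuous)]
    simpa using norm_integral_le_of_norm_le_const (μ := gaussianReal 0 1)
      (f := fun x => f (clamp R x) - P.eval (clamp R x)) (Eventually.of_forall hPc)

/-- Averages of continuous functions of polynomial growth along a good array converge to their
Gaussian expectation. -/
theorem GoodArray.tendsto_avg {u : (n : ℕ) → Fin n → ℝ} (hu : GoodArray u) {f : ℝ → ℝ}
    (hf : Continuous f) {C : ℝ} {K : ℕ} (hb : ∀ x, |f x| ≤ C * (1 + x ^ (2 * K))) :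
    Tendsto (fun n => avg f (u n)) atTop (𝓝 (∫ x, f x ∂(gaussianReal 0 1))) := by
  obtain ⟨C₁, h₁⟩ := hu.moment_bound 1
  obtain ⟨C₂, h₂⟩ := hu.moment_bound (K + 1)
  set m := ∫ x : ℝ, (x ^ (2 * 1) + x ^ (2 * (K + 1))) ∂(gaussianReal 0 1)
  have hC : 0 ≤ C := by
    have := (abs_nonneg _).trans (hb 0)
    by_contra hneg
    have h0 : (0 : ℝ) ≤ 0 ^ (2 * K) := by positivity
    nlinarith
  have hclose : ∀ R : ℕ, 0 < R → ∀ x, |f x - f (clamp R x)| ≤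
      2 * C / R * (x ^ (2 * 1) + x ^ (2 * (K + 1))) := by
    intro R hR x
    have hR' : (1 : ℝ) ≤ R := by exact_mod_cast hR
    have ev : ∀ j : ℕ, 0 ≤ x ^ (2 * j) := fun j => (even_two_mul j).pow_nonneg x
    rcases le_or_gt |x| R with hx | hx
    · rw [clamp_eq_self hx, sub_self, abs_zero]
      have := ev 1
      have := ev (K + 1)
      positivity
    · have h1 : |f (clamp R x)| ≤ C * (1 + x ^ (2 * K)) := by
        refine (hb _).trans ?_
        have h := pow_le_pow_left₀ (abs_nonneg _) (abs_clamp_le_abs (by linarith : (0 : ℝ) ≤ R) x)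
          (2 * K)
        rw [(even_two_mul K).pow_abs, (even_two_mul K).pow_abs] at h
        gcongr
      have h2 : (1 : ℝ) ≤ x ^ 2 / R := by
        rw [one_le_div (by linarith), ← sq_abs]
        nlinarith
      calc |f x - f (clamp R x)| ≤ |f x| + |f (clamp R x)| := abs_sub _ _
        _ ≤ C * (1 + x ^ (2 * K)) + C * (1 + x ^ (2 * K)) := add_le_add (hb x) h1
        _ = (2 * C * (1 + x ^ (2 * K))) * 1 := by ring
        _ ≤ (2 * C * (1 + x ^ (2 * K))) * (x ^ 2 / R) := by
            have := ev K
            gcongr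
        _ = _ := by ring
  refine tendsto_of_approx fun ε hε => ?_
  obtain ⟨R, hR⟩ := exists_nat_gt (2 * C * max (C₁ + C₂) m / ε)
  have hR' : 0 < R + 1 := Nat.succ_pos R
  have key : ∀ y ≤ max (C₁ + C₂) m, 2 * C / (R + 1 : ℕ) * y ≤ ε := by
    intro y hy
    have hpos : (0 : ℝ) < (R + 1 : ℕ) := by positivity
    rw [div_mul_eq_mul_div, div_le_iff₀ hpos]
    have h3 : 2 * C * max (C₁ + C₂) m < R * ε := (div_lt_iff₀ hε).1 hR
    have h4 : 2 * C * y ≤ 2 * C * max (C₁ + C₂) m := by gcongr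
    push_cast
    linarith
  have hpow : Integrable (fun x : ℝ => x ^ (2 * 1) + x ^ (2 * (K + 1))) (gaussianReal 0 1) :=
    (integrable_pow_gaussian _).add (integrable_pow_gaussian _)
  have hfi := integrable_gaussian_of_growth hf hb
  have hci : Integrable (fun x => f (clamp (R + 1 : ℕ) x)) (gaussianReal 0 1) := by
    have : Integrable (fun x => f x - f (clamp (R + 1 : ℕ) x)) (gaussianReal 0 1) :=
      Integrable.mono' (hpow.const_mul _)
        (hf.sub (hf.comp (continuous_clamp _))).aestronglyMeasurable
        (Eventually.of_forall (hclose (R + 1) hR'))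
    refine (hfi.sub this).congr (Eventually.of_forall fun x => ?_)
    simp
  refine ⟨_, _, hu.tendsto_avg_clamp hf (R + 1), ?_, ?_⟩
  · filter_upwards [h₁, h₂] with n hn₁ hn₂
    rw [← avg_sub]
    refine (abs_avg_le _ _).trans ((avg_mono (hclose _ hR') _).trans ?_)
    rw [avg_const_mul, avg_add]
    exact key _ ((add_le_add hn₁ hn₂).trans (le_max_left _ _))
  · rw [← integral_sub hfi hci]
    refine (abs_integral_le_integral_abs).trans ((integral_mono_of_nonneg
      (Eventually.of_forall fun _ => abs_nonneg _) (hpow.const_mul _)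
      (Eventually.of_forall (hclose _ hR'))).trans ?_)
    rw [integral_const_mul]
    exact key _ (le_max_right _ _)

/-! ### The generalized normal distribution -/

/-- The normalizing constant of the generalized normal density. -/
def normP (p : ℝ) : ℝ := 2 * p ^ (1/p) * Real.Gamma (1 + 1/p)

lemma normP_pos {p : ℝ} (hp : 1 < p) : 0 < normP p := by
  have h0 : 0 < p := by linarith
  have : 0 < Real.Gamma (1 + 1 / p) := Real.Gamma_pos_of_pos (by positivity)
  unfold normP; positivity

lemma integrable_comp_abs_of_Ioi {f : ℝ → ℝ} (hf : IntegrableOn f (Ioi 0)) :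
    Integrable (fun x => f |x|) := by
  have h1 : IntegrableOn (fun x => f |x|) (Ioi 0) :=
    hf.congr_fun (fun x hx => by rw [abs_of_pos hx]) measurableSet_Ioi
  have h2 : IntegrableOn (fun x => f |x|) (Iic 0) := by
    rw [← Measure.map_neg_eq_self (volume : Measure ℝ)]
    let m : MeasurableEmbedding fun x : ℝ => -x := (Homeomorph.neg ℝ).measurableEmbedding
    rw [m.integrableOn_map_iff]
    simp_rw [Function.comp_def, abs_neg, neg_preimage, neg_Iic, neg_zero]
    exact (integrableOn_Ici_iff_integrableOn_Ioi).2 h1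
  rw [← integrableOn_univ, ← Iic_union_Ioi (a := (0 : ℝ))]
  exact h2.union h1

lemma integrable_abs_rpow_mul_exp {p s b : ℝ} (hp : 1 < p) (hs : 0 ≤ s) (hb : 0 < b) :
    Integrable fun y : ℝ => |y| ^ s * Real.exp (-b * |y| ^ p) :=
  integrable_comp_abs_of_Ioi (integrableOn_rpow_mul_exp_neg_mul_rpow (by linarith) (by linarith) hb)

lemma integral_exp_neg_abs_rpow {p : ℝ} (hp : 1 < p) :
    ∫ y : ℝ, Real.exp (-(|y| ^ p) / p) = normP p := by
  have h0 : 0 < p := by linarith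
  have h := integral_comp_abs (f := fun x => Real.exp (-p⁻¹ * x ^ p))
  rw [integral_exp_neg_mul_rpow h0 (by positivity)] at h
  have e : ∀ y : ℝ, -(|y| ^ p) / p = -p⁻¹ * |y| ^ p := fun y => by ring
  simp only [e, h, normP]
  rw [Real.inv_rpow h0.le, ← Real.rpow_neg h0.le, neg_div, neg_neg, add_comm (1 / p), mul_assoc]

lemma muP_density_measurable (p : ℝ) : Measurable fun y : ℝ =>
    ENNReal.ofReal ((2 * p ^ (1/p) * Real.Gamma (1 + 1/p))⁻¹ * Real.exp (-(|y| ^ p) / p)) := by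
  fun_prop

lemma integral_muP {p : ℝ} (hp : 1 < p) (f : ℝ → ℝ) :
    ∫ y, f y ∂(muP p) = (normP p)⁻¹ * ∫ y, Real.exp (-(|y| ^ p) / p) * f y := by
  have := normP_pos hp
  unfold muP
  rw [integral_withDensity_eq_integral_toReal_smul (muP_density_measurable p) (by simp),
    ← integral_const_mul]
  refine integral_congr_ae (Eventually.of_forall fun y => ?_)
  simp only [smul_eq_mul]
  rw [ENNReal.toReal_ofReal (by unfold normP at this; positivity)]
  unfold normP
  ring

lemma integrable_muP_iff {p : ℝ} (hp : 1 < p) (f : ℝ → ℝ) :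
    Integrable f (muP p) ↔ Integrable (fun y => Real.exp (-(|y| ^ p) / p) * f y) := by
  have := normP_pos hp
  unfold muP
  rw [integrable_withDensity_iff_integrable_smul₀' (muP_density_measurable p).aemeasurable
    (by simp)]
  rw [← integrable_const_mul_iff (c := (normP p)⁻¹) (inv_ne_zero this.ne').isUnit
    (fun y => Real.exp (-(|y| ^ p) / p) * f y)]
  refine integrable_congr (Eventually.of_forall fun y => ?_)
  simp only [smul_eq_mul]
  rw [ENNReal.toReal_ofReal (by unfold normP at this; positivity)]
  unfold normP
  ring

lemma isProbabilityMeasure_muP {p : ℝ} (hp : 1 < p) : IsProbabilityMeasure (muP p) := by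
  have h0 : 0 < p := by linarith
  have := normP_pos hp
  refine ⟨?_⟩
  unfold muP
  rw [withDensity_apply _ MeasurableSet.univ, setLIntegral_univ,
    ← ofReal_integral_eq_lintegral_ofReal, integral_const_mul, integral_exp_neg_abs_rpow hp]
  · simp only [normP] at *
    rw [inv_mul_cancel₀ this.ne', ENNReal.ofReal_one]
  · refine Integrable.const_mul ?_ _
    refine (integrable_abs_rpow_mul_exp hp le_rfl (inv_pos.2 h0)).congr
      (Eventually.of_forall fun y => ?_)
    simp only [Real.rpow_zero, one_mul]
    congr 1; ring
  · exact Eventually.of_forall fun y => by unfold normP at this; positivity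

lemma muP_two : muP 2 = gaussianReal 0 1 := by
  rw [gaussianReal_of_var_ne_zero _ one_ne_zero]
  unfold muP
  congr 1
  funext y
  rw [gaussianPDF, gaussianPDFReal]
  have h : Real.Gamma (1 + 1 / 2) = 1 / 2 * √Real.pi := by
    rw [add_comm, Real.Gamma_add_one (by norm_num), Real.Gamma_one_half_eq]
  rw [h, ← Real.sqrt_eq_rpow]
  congr 2
  · congr 1
    rw [NNReal.coe_one, mul_one, Real.sqrt_mul (by norm_num)]
    ring
  · rw [show (2 : ℝ) = (2 : ℕ) by norm_num, Real.rpow_natCast, sq_abs]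
    simp

/-! ### Exponential moments and tilted measures -/

/-- A threshold beyond which `r * y` is dominated by `|y| ^ p / (2 * p)`. -/
def cut (p r : ℝ) : ℝ := (1 + 2 * p * |r|) ^ (1 / (p - 1))

lemma one_le_cut {p : ℝ} (hp : 1 < p) (r : ℝ) : 1 ≤ cut p r := by
  refine Real.one_le_rpow ?_ (by have : 0 < p - 1 := by linarith
                                 positivity)
  have : 0 < p := by linarith
  have := abs_nonneg r
  nlinarith [mul_nonneg (by linarith : (0:ℝ) ≤ 2 * p) this]

lemma mul_le_of_cut_le {p : ℝ} (hp : 1 < p) {r y : ℝ} (h : cut p r ≤ |y|) :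
    r * y ≤ |y| ^ p / (2 * p) := by
  have h0 : 0 < p := by linarith
  have hp1 : 0 < p - 1 := by linarith
  have hr := abs_nonneg r
  have hb : 0 ≤ 1 + 2 * p * |r| := by positivity
  have hc := one_le_cut hp r
  have hy : 0 < |y| := by linarith
  have h1 : 1 + 2 * p * |r| ≤ |y| ^ (p - 1) := by
    calc _ = cut p r ^ (p - 1) := by
          rw [cut, ← Real.rpow_mul hb, one_div_mul_cancel hp1.ne', Real.rpow_one]
      _ ≤ _ := Real.rpow_le_rpow (by linarith) h hp1.le
  have h2 : |y| ^ p = |y| ^ (p - 1) * |y| := by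
    rw [← Real.rpow_add_one hy.ne']; congr 1; ring
  rw [le_div_iff₀ (by positivity), h2]
  have h3 : r * y ≤ |r| * |y| := by rw [← abs_mul]; exact le_abs_self _
  nlinarith

lemma exp_mul_le {p : ℝ} (hp : 1 < p) (r y : ℝ) :
    Real.exp (r * y) ≤ Real.exp (|r| * cut p r) + Real.exp (|y| ^ p / (2 * p)) := by
  rcases le_total (cut p r) |y| with h | h
  · have := Real.exp_le_exp.2 (mul_le_of_cut_le hp h)
    linarith [Real.exp_pos (|r| * cut p r)]
  · have h3 : r * y ≤ |r| * cut p r := by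
      refine (le_abs_self _).trans ?_
      rw [abs_mul]
      gcongr
    have := Real.exp_le_exp.2 h3
    linarith [Real.exp_pos (|y| ^ p / (2 * p))]

lemma abs_rpow_mul_exp_mul_le {p s : ℝ} (hp : 1 < p) (hs : 0 ≤ s) (r y : ℝ) :
    |y| ^ s * Real.exp (r * y) ≤
      cut p r ^ s * Real.exp (r * y) + |y| ^ s * Real.exp (|y| ^ p / (2 * p)) := by
  have h0 := Real.exp_pos (r * y)
  have h1 := Real.exp_pos (|y| ^ p / (2 * p))
  have h2 : 0 ≤ |y| ^ s := by positivity
  have h3 := one_le_cut hp r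
  rcases le_total (cut p r) |y| with h | h
  · have := Real.exp_le_exp.2 (mul_le_of_cut_le hp h)
    have : |y| ^ s * Real.exp (r * y) ≤ |y| ^ s * Real.exp (|y| ^ p / (2 * p)) := by gcongr
    have : 0 ≤ cut p r ^ s * Real.exp (r * y) := by positivity
    linarith
  · have : |y| ^ s * Real.exp (r * y) ≤ cut p r ^ s * Real.exp (r * y) := by gcongr
    have : 0 ≤ |y| ^ s * Real.exp (|y| ^ p / (2 * p)) := by positivity
    linarith

lemma integrable_muP_dominating {p s : ℝ} (hp : 1 < p) (hs : 0 ≤ s) :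
    Integrable (fun y : ℝ => |y| ^ s * Real.exp (|y| ^ p / (2 * p))) (muP p) := by
  have h0 : 0 < p := by linarith
  rw [integrable_muP_iff hp]
  refine (integrable_abs_rpow_mul_exp hp hs (b := 1 / (2 * p)) (by positivity)).congr
    (Eventually.of_forall fun y => ?_)
  simp only
  rw [mul_left_comm, ← Real.exp_add]
  congr 2
  field_simp
  ring

lemma integrable_muP_of_bound {p s : ℝ} (hp : 1 < p) (hs : 0 ≤ s) {f : ℝ → ℝ}
    (hf : AEStronglyMeasurable f (muP p)) {C : ℝ}
    (h : ∀ y, |f y| ≤ C * (|y| ^ s * Real.exp (|y| ^ p / (2 * p)))) : Integrable f (muP p) :=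
  Integrable.mono' ((integrable_muP_dominating hp hs).const_mul C) hf (Eventually.of_forall h)

lemma integrable_muP_exp_mul_of_le {p s : ℝ} (hp : 1 < p) (hs : 0 ≤ s) {f : ℝ → ℝ}
    (hf : Continuous f) (h : ∀ y, |f y| ≤ |y| ^ s) (r : ℝ) :
    Integrable (fun y => Real.exp (r * y) * f y) (muP p) := by
  have h0 : 0 < p := by linarith
  refine integrable_muP_of_bound hp hs (C := Real.exp (|r| * cut p r) + 1)
    (by fun_prop) fun y => ?_
  rw [abs_mul, abs_of_pos (Real.exp_pos _)]
  have h1 : 1 ≤ Real.exp (|y| ^ p / (2 * p)) := Real.one_le_exp (by positivity)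
  have h2 := exp_mul_le hp r y
  have h3 : Real.exp (r * y) ≤ (Real.exp (|r| * cut p r) + 1) * Real.exp (|y| ^ p / (2 * p)) := by
    nlinarith [Real.exp_pos (|r| * cut p r)]
  calc _ ≤ (Real.exp (|r| * cut p r) + 1) * Real.exp (|y| ^ p / (2 * p)) * |y| ^ s := by
        gcongr
        exact h y
    _ = _ := by ring

lemma integrable_exp_mul_muP {p : ℝ} (hp : 1 < p) (r : ℝ) :
    Integrable (fun y => Real.exp (r * y)) (muP p) := by
  simpa using integrable_muP_exp_mul_of_le hp le_rfl (f := fun _ => 1) (by fun_prop)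
    (by simp) r

/-- The exponentially tilted generalized normal distribution. -/
def tilt (p r : ℝ) : Measure ℝ := (muP p).tilted (fun y => r * y)

lemma isProbabilityMeasure_tilt {p : ℝ} (hp : 1 < p) (r : ℝ) :
    IsProbabilityMeasure (tilt p r) := by
  have := isProbabilityMeasure_muP hp
  exact isProbabilityMeasure_tilted (integrable_exp_mul_muP hp r)

/-- The log moment generating function of the generalized normal distribution. -/
def lam (p r : ℝ) : ℝ := cgf id (muP p) r

/-- The mean of the tilted distribution. -/
def mean (p r : ℝ) : ℝ := ∫ y, y ∂(tilt p r)

lemma integrable_tilt {p s : ℝ} (hp : 1 < p) (hs : 0 ≤ s) {f : ℝ → ℝ}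
    (hf : Continuous f) (h : ∀ y, |f y| ≤ |y| ^ s) (r : ℝ) : Integrable f (tilt p r) := by
  rw [tilt, integrable_tilted_iff (integrable_exp_mul_muP hp r)]
  exact integrable_muP_exp_mul_of_le hp hs hf h r

lemma integrableExpSet_muP {p : ℝ} (hp : 1 < p) : integrableExpSet id (muP p) = univ :=
  eq_univ_of_forall fun r => integrable_exp_mul_muP hp r

lemma hasDerivAt_lam {p : ℝ} (hp : 1 < p) (r : ℝ) : HasDerivAt (lam p) (mean p r) r := by
  have hr : r ∈ interior (integrableExpSet id (muP p)) := by simp [integrableExpSet_muP hp]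
  have h := integral_tilted_mul_self hr
  have : mean p r = deriv (cgf id (muP p)) r := h
  rw [this]
  exact (analyticAt_cgf hr).differentiableAt.hasDerivAt

lemma continuous_mean {p : ℝ} (hp : 1 < p) : Continuous (mean p) := by
  have e : mean p = deriv (cgf id (muP p)) := funext fun r => ((hasDerivAt_lam hp r).deriv).symm
  rw [e]
  refine continuous_iff_continuousAt.2 fun r => ?_
  have hr : r ∈ interior (integrableExpSet id (muP p)) := by simp [integrableExpSet_muP hp]
  exact (analyticAt_cgf hr).deriv.continuousAt

lemma continuous_lam {p : ℝ} (hp : 1 < p) : Continuous (lam p) :=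
  continuous_iff_continuousAt.2 fun r => (hasDerivAt_lam hp r).continuousAt

lemma map_neg_muP (p : ℝ) : (muP p).map (fun y => -y) = muP p := by
  unfold muP
  refine Measure.ext fun s hs => ?_
  rw [Measure.map_apply measurable_neg hs, withDensity_apply _ (measurable_neg hs),
    withDensity_apply _ hs]
  have h := (Measure.measurePreserving_neg (volume : Measure ℝ)).setLIntegral_comp_preimage hs
    (muP_density_measurable p)
  simpa using h

lemma integral_comp_neg_muP (p : ℝ) (f : ℝ → ℝ) : ∫ y, f (-y) ∂(muP p) = ∫ y, f y ∂(muP p) := by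
  have h := integral_map_equiv (μ := muP p) (MeasurableEquiv.neg ℝ) f
  simp only [MeasurableEquiv.neg_apply] at h
  rw [← h]
  exact congrArg (fun ν => ∫ y, f y ∂ν) (map_neg_muP p)

lemma lam_neg (p r : ℝ) : lam p (-r) = lam p r := by
  unfold lam cgf mgf
  rw [← integral_comp_neg_muP]
  simp

lemma exp_lam {p : ℝ} (hp : 1 < p) (r : ℝ) :
    Real.exp (lam p r) = ∫ y, Real.exp (r * y) ∂(muP p) := by
  have := isProbabilityMeasure_muP hp
  exact exp_cgf (X := id) (integrable_exp_mul_muP hp r)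

lemma lam_zero {p : ℝ} (hp : 1 < p) : lam p 0 = 0 := by
  have := isProbabilityMeasure_muP hp
  exact cgf_zero

lemma lam_nonneg {p : ℝ} (hp : 1 < p) (r : ℝ) : 0 ≤ lam p r := by
  have := isProbabilityMeasure_muP hp
  rw [← Real.one_le_exp_iff, exp_lam hp]
  have h1 : Integrable (fun y => r * y) (muP p) := by
    refine Integrable.const_mul ?_ r
    simpa using integrable_muP_exp_mul_of_le hp zero_le_one (f := fun y => y) (by fun_prop)
      (by simp) 0
  have h2 : ∫ y, r * y ∂(muP p) = 0 := by
    have := integral_comp_neg_muP p (fun y => r * y)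
    simp only [mul_neg, integral_neg] at this
    linarith
  calc (1 : ℝ) = ∫ y, (r * y + 1) ∂(muP p) := by
        rw [integral_add h1 (integrable_const 1), h2]; simp
    _ ≤ _ := integral_mono (h1.add (integrable_const 1)) (integrable_exp_mul_muP hp r)
        fun y => Real.add_one_le_exp _

lemma integral_tilt {p : ℝ} (hp : 1 < p) (r : ℝ) (f : ℝ → ℝ) :
    ∫ y, f y ∂(tilt p r) = Real.exp (-lam p r) * ∫ y, Real.exp (r * y) * f y ∂(muP p) := by
  rw [tilt, integral_tilted, ← exp_lam hp, ← integral_const_mul]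
  refine integral_congr_ae (Eventually.of_forall fun y => ?_)
  simp only [smul_eq_mul, Real.exp_neg]
  ring

/-- The constant in the polynomial bound for moments of tilted measures. -/
def momConst (p s : ℝ) : ℝ := ∫ y, |y| ^ s * Real.exp (|y| ^ p / (2 * p)) ∂(muP p)

lemma momConst_nonneg (p s : ℝ) : 0 ≤ momConst p s :=
  integral_nonneg fun y => by positivity

lemma integral_tilt_abs_rpow_le {p s : ℝ} (hp : 1 < p) (hs : 0 ≤ s) (r : ℝ) :
    ∫ y, |y| ^ s ∂(tilt p r) ≤ cut p r ^ s + momConst p s := by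
  have hc : Continuous fun y : ℝ => |y| ^ s :=
    continuous_abs.rpow_const fun _ => Or.inr hs
  have hi := integrable_muP_exp_mul_of_le hp hs hc
    (fun y => by rw [abs_of_nonneg (by positivity)]) r
  have he := integrable_exp_mul_muP hp r
  have hd := integrable_muP_dominating hp hs
  have h : ∫ y, Real.exp (r * y) * |y| ^ s ∂(muP p) ≤
      cut p r ^ s * Real.exp (lam p r) + momConst p s := by
    rw [exp_lam hp, ← integral_const_mul, momConst, ← integral_add (he.const_mul _) hd]
    refine integral_mono hi ((he.const_mul _).add hd) fun y => ?_
    have := abs_rpow_mul_exp_mul_le hp hs r y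
    simp only
    linarith
  rw [integral_tilt hp]
  have h1 : Real.exp (-lam p r) ≤ 1 := Real.exp_le_one_iff.2 (by linarith [lam_nonneg hp r])
  calc _ ≤ Real.exp (-lam p r) * (cut p r ^ s * Real.exp (lam p r) + momConst p s) := by gcongr
    _ = cut p r ^ s + Real.exp (-lam p r) * momConst p s := by
        rw [mul_add, mul_left_comm, ← Real.exp_add]; simp
    _ ≤ _ := by
        have := mul_le_of_le_one_left (momConst_nonneg p s) h1
        linarith

lemma lam_le {p : ℝ} (hp : 1 < p) (r : ℝ) : lam p r ≤ |r| * cut p r + momConst p 0 := by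
  have := isProbabilityMeasure_muP hp
  have hd := integrable_muP_dominating hp (le_refl (0 : ℝ))
  have hc := one_le_cut hp r
  have h1 : Real.exp (lam p r) ≤ Real.exp (|r| * cut p r) + momConst p 0 := by
    rw [exp_lam hp, momConst]
    calc _ ≤ ∫ y, (Real.exp (|r| * cut p r) + |y| ^ (0 : ℝ) * Real.exp (|y| ^ p / (2 * p)))
          ∂(muP p) :=
          integral_mono (integrable_exp_mul_muP hp r) ((integrable_const _).add hd) fun y => by
            simpa using exp_mul_le hp r y
      _ = _ := by rw [integral_add (integrable_const _) hd]; simp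
  refine Real.exp_le_exp.1 (h1.trans ?_)
  rw [Real.exp_add]
  have h2 := Real.add_one_le_exp (momConst p 0)
  have h3 : 1 ≤ Real.exp (|r| * cut p r) := Real.one_le_exp (by positivity)
  nlinarith [momConst_nonneg p 0]

lemma abs_mean_le {p : ℝ} (hp : 1 < p) (r : ℝ) : |mean p r| ≤ cut p r + momConst p 1 := by
  have h := integral_tilt_abs_rpow_le hp zero_le_one r
  simp only [Real.rpow_one] at h
  exact abs_integral_le_integral_abs.trans h

lemma mul_mean_nonneg {p : ℝ} (hp : 1 < p) (r : ℝ) : 0 ≤ r * mean p r := by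
  have hP := isProbabilityMeasure_tilt hp r
  have h1 : Integrable (fun y => r * y) (tilt p r) :=
    (integrable_tilt hp zero_le_one continuous_id (fun y => by simp) r).const_mul r
  have h2 : ∫ y, Real.exp (-(r * y)) ∂(tilt p r) = Real.exp (-lam p r) := by
    have := isProbabilityMeasure_muP hp
    rw [integral_tilt hp]
    simp [← Real.exp_add]
  have h3 : Integrable (fun y => Real.exp (-(r * y))) (tilt p r) := by
    by_contra hn
    rw [integral_undef hn] at h2
    exact (Real.exp_pos _).ne h2
  have h4 : ∫ y, (-(r * y) + 1) ∂(tilt p r) ≤ Real.exp (-lam p r) := by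
    rw [← h2]
    exact integral_mono (h1.neg.add (integrable_const 1)) h3 fun y => Real.add_one_le_exp _
  have h6 : ∫ y, (-(r * y) + 1) ∂(tilt p r) = -(r * mean p r) + 1 := by
    rw [integral_add (f := fun y => -(r * y)) h1.neg (integrable_const 1), integral_neg,
      integral_const_mul]
    simp [mean]
  have h5 : Real.exp (-lam p r) ≤ 1 := Real.exp_le_one_iff.2 (by linarith [lam_nonneg hp r])
  linarith

lemma mean_zero {p : ℝ} (hp : 1 < p) : mean p 0 = 0 := by
  have h := integral_comp_neg_muP p (fun y => y)
  rw [mean, integral_tilt hp, lam_zero hp]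
  rw [integral_neg] at h
  simp
  linarith

lemma integral_tilt_abs_rpow {p : ℝ} (hp : 1 < p) (r : ℝ) :
    ∫ y, |y| ^ p ∂(tilt p r) = 1 + r * mean p r := by
  have h0 : 0 < p := by linarith
  have hP := isProbabilityMeasure_tilt hp r
  set f : ℝ → ℝ := fun y => Real.exp (r * y + -(|y| ^ p) / p)
  have hcp : Continuous fun y : ℝ => |y| ^ p := continuous_abs.rpow_const fun _ => Or.inr h0.le
  have key : ∀ {s : ℝ} {g : ℝ → ℝ}, 0 ≤ s → Continuous g → (∀ y, |g y| ≤ |y| ^ s) →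
      Integrable (fun y => f y * g y) := fun {s g} hs hg hb => by
    refine ((integrable_muP_iff hp _).1 (integrable_muP_exp_mul_of_le hp hs hg hb r)).congr
      (Eventually.of_forall fun y => ?_)
    simp only [f, Real.exp_add]
    ring
  have i0 : Integrable (fun y => f y * 1) := key le_rfl (g := fun _ => 1) (by fun_prop) (by simp)
  have i1 : Integrable (fun y => f y * y) := key zero_le_one continuous_id (by simp)
  have ip : Integrable (fun y => f y * |y| ^ p) :=
    key h0.le hcp (fun y => by rw [abs_of_nonneg (by positivity)])
  have hder : ∀ y, HasDerivAt (fun y => f y * y) (f y * 1 + r * (f y * y) - f y * |y| ^ p) y := by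
    intro y
    have h1 : HasDerivAt (fun y => r * y + -(|y| ^ p) / p)
        (r + -(p * |y| ^ (p - 2) * y) / p) y := by
      have h := ((hasDerivAt_id y).const_mul r).add ((hasDerivAt_abs_rpow y hp).neg.div_const p)
      rw [mul_one] at h
      exact h
    have h2 := (h1.exp).mul (hasDerivAt_id y)
    refine h2.congr_deriv ?_
    have h3 : |y| ^ (p - 2) * y * y = |y| ^ p := by
      rcases eq_or_ne y 0 with rfl | hy
      · simp [h0.ne']
      · have hy' : 0 < |y| := abs_pos.2 hy
        rw [mul_assoc, ← sq, ← sq_abs, ← Real.rpow_natCast |y| 2, ← Real.rpow_add hy']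
        norm_num
    simp only [f, id]
    generalize Real.exp (r * y + -|y| ^ p / p) = e
    rw [← h3]
    field_simp
    ring
  have h := integral_eq_zero_of_hasDerivAt_of_integrable hder
    ((i0.add (i1.const_mul r)).sub ip) i1
  rw [integral_sub (f := fun y => f y * 1 + r * (f y * y)) (i0.add (i1.const_mul r)) ip,
    integral_add i0 (i1.const_mul r), integral_const_mul] at h
  have ht : ∀ g : ℝ → ℝ, ∫ y, g y ∂(tilt p r) =
      Real.exp (-lam p r) * (normP p)⁻¹ * ∫ y, f y * g y := fun g => by
    rw [integral_tilt hp, integral_muP hp, mul_assoc]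
    congr 2
    refine integral_congr_ae (Eventually.of_forall fun y => ?_)
    simp only [f, Real.exp_add]
    ring
  have h1 : ∫ _, (1 : ℝ) ∂(tilt p r) = 1 := by simp
  rw [ht] at h1
  rw [mean, ht, ht, ← h1]
  rw [sub_eq_zero] at h
  rw [← h]
  ring

/-- Functions on the line dominated by a polynomial. -/
def PolyGrowth (f : ℝ → ℝ) : Prop := ∃ (C : ℝ) (K : ℕ), 0 ≤ C ∧ ∀ x, |f x| ≤ C * (1 + |x|) ^ K

lemma PolyGrowth.mono {f g : ℝ → ℝ} (hg : PolyGrowth g) (h : ∀ x, |f x| ≤ |g x|) :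
    PolyGrowth f := by
  obtain ⟨C, K, hC, hb⟩ := hg
  exact ⟨C, K, hC, fun x => (h x).trans (hb x)⟩

lemma polyGrowth_const (c : ℝ) : PolyGrowth fun _ => c := ⟨|c|, 0, abs_nonneg _, by simp⟩

lemma polyGrowth_id : PolyGrowth fun x => x := ⟨1, 1, zero_le_one, by simp⟩

lemma PolyGrowth.mul {f g : ℝ → ℝ} (hf : PolyGrowth f) (hg : PolyGrowth g) :
    PolyGrowth fun x => f x * g x := by
  obtain ⟨C, K, hC, hb⟩ := hf
  obtain ⟨D, L, hD, hd⟩ := hg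
  refine ⟨C * D, K + L, by positivity, fun x => ?_⟩
  rw [abs_mul]
  calc _ ≤ (C * (1 + |x|) ^ K) * (D * (1 + |x|) ^ L) :=
        mul_le_mul (hb x) (hd x) (abs_nonneg _) (by positivity)
    _ = _ := by ring

lemma PolyGrowth.add {f g : ℝ → ℝ} (hf : PolyGrowth f) (hg : PolyGrowth g) :
    PolyGrowth fun x => f x + g x := by
  obtain ⟨C, K, hC, hb⟩ := hf
  obtain ⟨D, L, hD, hd⟩ := hg
  refine ⟨C + D, K + L, by positivity, fun x => ?_⟩
  have h1 : 1 ≤ 1 + |x| := by linarith [abs_nonneg x]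
  calc |f x + g x| ≤ |f x| + |g x| := abs_add_le _ _
    _ ≤ C * (1 + |x|) ^ (K + L) + D * (1 + |x|) ^ (K + L) := by
        refine add_le_add ((hb x).trans ?_) ((hd x).trans ?_)
        · exact mul_le_mul_of_nonneg_left (pow_le_pow_right₀ h1 (Nat.le_add_right _ _)) hC
        · exact mul_le_mul_of_nonneg_left (pow_le_pow_right₀ h1 (Nat.le_add_left _ _)) hD
    _ = _ := by ring

lemma PolyGrowth.bound_comp_mul {f : ℝ → ℝ} (hf : PolyGrowth f) (T : ℝ) :
    ∃ g : ℝ → ℝ, PolyGrowth g ∧ Continuous g ∧ ∀ t x, |t| ≤ T → |f (t * x)| ≤ g x := by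
  obtain ⟨C, K, hC, hb⟩ := hf
  refine ⟨fun x => C * (1 + |T|) ^ K * (1 + |x|) ^ K, ⟨C * (1 + |T|) ^ K, K, by positivity,
    fun x => ?_⟩, by fun_prop, fun t x ht => (hb _).trans ?_⟩
  · rw [abs_of_nonneg (by positivity)]
  · simp only
    rw [mul_assoc, ← mul_pow]
    have h0 := abs_nonneg t
    have h1 := abs_nonneg x
    have h2 : |t| ≤ |T| := ht.trans (le_abs_self T)
    gcongr
    rw [abs_mul]
    nlinarith

lemma PolyGrowth.comp_mul {f : ℝ → ℝ} (hf : PolyGrowth f) (t : ℝ) :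
    PolyGrowth fun x => f (t * x) := by
  obtain ⟨g, hg, _, h⟩ := hf.bound_comp_mul |t|
  exact hg.mono fun x => (h t x le_rfl).trans (le_abs_self _)

lemma PolyGrowth.even_bound {f : ℝ → ℝ} (hf : PolyGrowth f) :
    ∃ (C : ℝ) (K : ℕ), ∀ x, |f x| ≤ C * (1 + x ^ (2 * K)) := by
  obtain ⟨C, K, hC, hb⟩ := hf
  refine ⟨C * 2 ^ (2 * K - 1), K, fun x => (hb x).trans ?_⟩
  have h1 : 1 ≤ 1 + |x| := by linarith [abs_nonneg x]
  have h2 := add_pow_le zero_le_one (abs_nonneg x) (2 * K)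
  rw [one_pow, (even_two_mul K).pow_abs] at h2
  rw [mul_assoc]
  exact mul_le_mul_of_nonneg_left
    ((pow_le_pow_right₀ h1 (by omega)).trans h2) hC

lemma PolyGrowth.integrable {f : ℝ → ℝ} (hf : PolyGrowth f) (hc : Continuous f) :
    Integrable f (gaussianReal 0 1) := by
  obtain ⟨C, K, hb⟩ := hf.even_bound
  exact integrable_gaussian_of_growth hc hb

lemma GoodArray.tendsto {u : (n : ℕ) → Fin n → ℝ} (hu : GoodArray u) {f : ℝ → ℝ}
    (hc : Continuous f) (hf : PolyGrowth f) :
    Tendsto (fun n => avg f (u n)) atTop (𝓝 (∫ x, f x ∂(gaussianReal 0 1))) := by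
  obtain ⟨C, K, hb⟩ := hf.even_bound
  exact hu.tendsto_avg hc hb

lemma continuous_cut {p : ℝ} (hp : 1 < p) : Continuous (cut p) := by
  have h0 : 0 < p := by linarith
  unfold cut
  refine Continuous.rpow_const (by fun_prop) fun r => Or.inl ?_
  positivity

lemma polyGrowth_cut_rpow {p : ℝ} (hp : 1 < p) (s : ℝ) :
    PolyGrowth fun r => cut p r ^ s := by
  have h0 : 0 < p := by linarith
  obtain ⟨K, hK⟩ := exists_nat_ge (1 / (p - 1) * s)
  refine ⟨(1 + 2 * p) ^ K, K, by positivity, fun r => ?_⟩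
  have hr := abs_nonneg r
  have hb : 1 ≤ 1 + 2 * p * |r| := by
    have : 0 ≤ 2 * p * |r| := by positivity
    linarith
  simp only [cut]
  rw [← Real.rpow_mul (by linarith), abs_of_nonneg (by positivity), ← mul_pow]
  calc _ ≤ (1 + 2 * p * |r|) ^ (K : ℝ) := Real.rpow_le_rpow_of_exponent_le hb hK
    _ = (1 + 2 * p * |r|) ^ K := Real.rpow_natCast _ _
    _ ≤ _ := by gcongr; nlinarith

lemma polyGrowth_cut {p : ℝ} (hp : 1 < p) : PolyGrowth (cut p) := by
  simpa using polyGrowth_cut_rpow hp 1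

lemma polyGrowth_lam {p : ℝ} (hp : 1 < p) : PolyGrowth (lam p) := by
  have habs : PolyGrowth fun r => |r| := polyGrowth_id.mono fun r => (abs_abs r).le
  refine ((habs.mul (polyGrowth_cut hp)).add (polyGrowth_const (momConst p 0))).mono fun r => ?_
  rw [abs_of_nonneg (lam_nonneg hp r)]
  exact (lam_le hp r).trans (le_abs_self _)

lemma polyGrowth_mean {p : ℝ} (hp : 1 < p) : PolyGrowth (mean p) :=
  ((polyGrowth_cut hp).add (polyGrowth_const (momConst p 1))).mono fun r =>
    (abs_mean_le hp r).trans (le_abs_self _)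

/-- The limiting normalized log moment generating function `∫ Λ(t u) γ(du)`. -/
def kappa (p t : ℝ) : ℝ := ∫ u, lam p (t * u) ∂(gaussianReal 0 1)

/-- The derivative `∫ u Λ'(t u) γ(du)` of `kappa`. -/
def kappaDeriv (p t : ℝ) : ℝ := ∫ u, u * mean p (t * u) ∂(gaussianReal 0 1)

/-- The limiting normalized `ℓ^p` radius of tilted vectors. -/
def radius (p t : ℝ) : ℝ := (1 + t * kappaDeriv p t) ^ (1 / p)

lemma polyGrowth_mul_mean {p : ℝ} (hp : 1 < p) (t : ℝ) :
    PolyGrowth fun u => u * mean p (t * u) :=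
  polyGrowth_id.mul ((polyGrowth_mean hp).comp_mul t)

lemma continuous_mul_mean {p : ℝ} (hp : 1 < p) (t : ℝ) :
    Continuous fun u => u * mean p (t * u) := by
  have := continuous_mean hp
  fun_prop

lemma continuous_kappaDeriv {p : ℝ} (hp : 1 < p) : Continuous (kappaDeriv p) := by
  refine continuous_iff_continuousAt.2 fun t₀ => ?_
  obtain ⟨g, hg, hgc, hb⟩ := (polyGrowth_mean hp).bound_comp_mul (|t₀| + 1)
  have hm := continuous_mean hp
  refine continuousAt_of_dominated (bound := fun u => |u| * g u)
    (Eventually.of_forall fun t => (continuous_mul_mean hp t).aestronglyMeasurable) ?_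
    ?_ (Eventually.of_forall fun u => by fun_prop)
  · filter_upwards [Metric.ball_mem_nhds t₀ one_pos] with t ht
    refine Eventually.of_forall fun u => ?_
    rw [Real.norm_eq_abs, abs_mul]
    refine mul_le_mul_of_nonneg_left (hb t u ?_) (abs_nonneg _)
    rw [mem_ball_iff_norm, Real.norm_eq_abs] at ht
    have := abs_sub_abs_le_abs_sub t t₀
    linarith
  · exact PolyGrowth.integrable ((polyGrowth_id.mul hg).mono fun u => by simp [abs_mul])
      (by fun_prop)

lemma kappa_zero {p : ℝ} (hp : 1 < p) : kappa p 0 = 0 := by simp [kappa, lam_zero hp]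

lemma kappa_neg (p t : ℝ) : kappa p (-t) = kappa p t := by
  simp only [kappa, neg_mul, lam_neg]

lemma kappaDeriv_zero {p : ℝ} (hp : 1 < p) : kappaDeriv p 0 = 0 := by
  simp [kappaDeriv, mean_zero hp]

lemma mul_kappaDeriv_nonneg {p : ℝ} (hp : 1 < p) (t : ℝ) : 0 ≤ t * kappaDeriv p t := by
  rw [kappaDeriv, ← integral_const_mul]
  refine integral_nonneg fun u => ?_
  show 0 ≤ t * (u * mean p (t * u))
  rw [← mul_assoc]
  exact mul_mean_nonneg hp _

lemma one_le_radius {p : ℝ} (hp : 1 < p) (t : ℝ) : 1 ≤ radius p t :=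
  Real.one_le_rpow (by linarith [mul_kappaDeriv_nonneg hp t])
    (by have : 0 < p := by linarith
        positivity)

lemma radius_rpow {p : ℝ} (hp : 1 < p) (t : ℝ) : radius p t ^ p = 1 + t * kappaDeriv p t := by
  have h0 : 0 < p := by linarith
  have := mul_kappaDeriv_nonneg hp t
  rw [radius, ← Real.rpow_mul (by linarith), one_div_mul_cancel h0.ne', Real.rpow_one]

lemma continuous_radius {p : ℝ} (hp : 1 < p) : Continuous (radius p) := by
  have := continuous_kappaDeriv hp
  unfold radius
  refine Continuous.rpow_const (by fun_prop) fun t => Or.inl ?_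
  linarith [mul_kappaDeriv_nonneg hp t]

lemma GoodArray.tendsto_kappa {p : ℝ} (hp : 1 < p) {u : (n : ℕ) → Fin n → ℝ} (hu : GoodArray u)
    (t : ℝ) : Tendsto (fun n => avg (fun x => lam p (t * x)) (u n)) atTop (𝓝 (kappa p t)) :=
  hu.tendsto ((continuous_lam hp).comp (continuous_const.mul continuous_id))
    ((polyGrowth_lam hp).comp_mul t)

lemma GoodArray.tendsto_kappaDeriv {p : ℝ} (hp : 1 < p) {u : (n : ℕ) → Fin n → ℝ}
    (hu : GoodArray u) (t : ℝ) :
    Tendsto (fun n => avg (fun x => x * mean p (t * x)) (u n)) atTop (𝓝 (kappaDeriv p t)) :=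
  hu.tendsto (continuous_mul_mean hp t) (polyGrowth_mul_mean hp t)

/-! ### A variational formula for the rate function -/

/-- The exponent whose supremum over `t ∈ ℝ`, `a > 0` is the rate function. -/
def rateExp (p w t a : ℝ) : ℝ := t * a * w + (1 - a ^ p) / p - kappa p t + Real.log a

/-- The rate function, written as a supremum of real-valued exponents. -/
def rate (p w : ℝ) : EReal := ⨆ q : ℝ × Ioi (0 : ℝ), ((rateExp p w q.1 q.2 : ℝ) : EReal)

lemma rateExp_le_rate (p w t : ℝ) {a : ℝ} (ha : 0 < a) : (rateExp p w t a : EReal) ≤ rate p w :=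
  le_iSup (fun q : ℝ × Ioi (0 : ℝ) => ((rateExp p w q.1 q.2 : ℝ) : EReal)) (t, ⟨a, ha⟩)

lemma integrable_scaled {p : ℝ} (hp : 1 < p) (r : ℝ) {a : ℝ} (ha : 0 < a) :
    Integrable (fun y => Real.exp (r * y + (1 / p - a ^ p / p) * |y| ^ p)) (muP p) ∧
    ∫ y, Real.exp (r * y + (1 / p - a ^ p / p) * |y| ^ p) ∂(muP p) =
      a⁻¹ * Real.exp (lam p (r / a)) := by
  set h : ℝ → ℝ := fun x => Real.exp (-(|x| ^ p) / p) * Real.exp (r / a * x)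
  have hi : Integrable h := (integrable_muP_iff hp _).1 (integrable_exp_mul_muP hp _)
  have e : ∀ y, Real.exp (-(|y| ^ p) / p) * Real.exp (r * y + (1 / p - a ^ p / p) * |y| ^ p) =
      h (a * y) := fun y => by
    simp only [h, ← Real.exp_add]
    rw [abs_mul, Real.mul_rpow (abs_nonneg _) (abs_nonneg _), abs_of_pos ha]
    congr 1
    field_simp
    ring
  constructor
  · rw [integrable_muP_iff hp]
    simp only [e]
    exact hi.comp_mul_left' ha.ne'
  · rw [integral_muP hp]
    simp only [e]
    rw [Measure.integral_comp_mul_left h a, exp_lam hp, integral_muP hp, smul_eq_mul,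
      abs_of_pos (inv_pos.2 ha)]
    ring

lemma LamP_scaled {p : ℝ} (hp : 1 < p) (r : ℝ) {a : ℝ} (ha : 0 < a) :
    LamP p (r, 1 / p - a ^ p / p) = ((lam p (r / a) - Real.log a : ℝ) : EReal) := by
  obtain ⟨hi, he⟩ := integrable_scaled hp r ha
  unfold LamP
  rw [← ofReal_integral_eq_lintegral_ofReal hi (Eventually.of_forall fun y => (Real.exp_pos _).le),
    he, ENNReal.log_ofReal_of_pos (by positivity), Real.log_mul (by positivity) (by positivity),
    Real.log_exp, Real.log_inv]
  congr 1
  ring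

lemma LamP_eq_top {p : ℝ} (hp : 1 < p) (r : ℝ) {c : ℝ} (hc : 1 / p ≤ c) :
    LamP p (r, c) = ⊤ := by
  have h0 : 0 < p := by linarith
  have hN := normP_pos hp
  unfold LamP
  rw [ENNReal.log_eq_top_iff, muP, lintegral_withDensity_eq_lintegral_mul _
    (muP_density_measurable p) (by fun_prop)]
  have key : ∀ y ∈ {y : ℝ | 0 ≤ r * y}, ENNReal.ofReal (normP p)⁻¹ ≤
      ((fun y => ENNReal.ofReal ((2 * p ^ (1/p) * Real.Gamma (1 + 1/p))⁻¹ *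
        Real.exp (-(|y| ^ p) / p))) * fun y =>
          ENNReal.ofReal (Real.exp (r * y + c * |y| ^ p))) y := by
    intro y hy
    rw [mem_ofPred_eq] at hy
    have hy' : 0 ≤ |y| ^ p := by positivity
    rw [Pi.mul_apply, ← ENNReal.ofReal_mul (by unfold normP at hN; positivity), mul_assoc,
      ← Real.exp_add]
    refine ENNReal.ofReal_le_ofReal (le_mul_of_one_le_right (inv_pos.2 hN).le (Real.one_le_exp ?_))
    have : 1 / p * |y| ^ p ≤ c * |y| ^ p := by gcongr
    have : -(|y| ^ p) / p = -(1 / p * |y| ^ p) := by ring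
    linarith
  have hinf : volume {y : ℝ | 0 ≤ r * y} = ⊤ := by
    rcases le_total 0 r with h | h
    · refine measure_mono_top (s₁ := Ici 0) (fun y hy => mul_nonneg h hy) (by simp)
    · refine measure_mono_top (s₁ := Iic 0) (fun y hy => mul_nonneg_of_nonpos_of_nonpos h hy)
        (by simp)
  refine eq_top_mono (setLIntegral_le_lintegral {y : ℝ | 0 ≤ r * y} _) ?_
  refine eq_top_mono (setLIntegral_mono' (measurableSet_le measurable_const (by fun_prop)) key) ?_
  rw [setLIntegral_const, hinf, ENNReal.mul_top]
  simpa using hN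

lemma eIntegral_coe {ν : Measure ℝ} {f : ℝ → ℝ} (hf : Integrable f ν) :
    eIntegral ν (fun u => (f u : EReal)) = ((∫ u, f u ∂ν : ℝ) : EReal) := by
  have e : ∀ x : ℝ, erealToENNReal (x : EReal) = ENNReal.ofReal x := fun x => by
    simp [erealToENNReal]
  have e' : ∀ x : ℝ, erealToENNReal (-(x : EReal)) = ENNReal.ofReal (-x) := fun x => by
    rw [← EReal.coe_neg, e]
  unfold eIntegral
  simp only [e, e']
  have h1 : ∫⁻ u, ENNReal.ofReal (f u) ∂ν ≠ ⊤ := hf.lintegral_lt_top.ne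
  have h2 : ∫⁻ u, ENNReal.ofReal (-f u) ∂ν ≠ ⊤ := hf.neg.lintegral_lt_top.ne
  rw [integral_eq_lintegral_pos_part_sub_lintegral_neg_part hf, EReal.coe_sub,
    EReal.coe_ennreal_toReal h1, EReal.coe_ennreal_toReal h2]

lemma eIntegral_top {ν : Measure ℝ} [IsProbabilityMeasure ν] : eIntegral ν (fun _ => ⊤) = ⊤ := by
  simp [eIntegral, erealToENNReal]

lemma Psi_scaled {p : ℝ} (hp : 1 < p) (t : ℝ) {a : ℝ} (ha : 0 < a) :
    Psi p (muP 2) (t * a, 1 / p - a ^ p / p) = ((kappa p t - Real.log a : ℝ) : EReal) := by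
  have e : ∀ u : ℝ, LamP p (t * a * u, 1 / p - a ^ p / p) =
      ((lam p (t * u) - Real.log a : ℝ) : EReal) := fun u => by
    rw [LamP_scaled hp _ ha]
    congr 4
    field_simp
  have hi : Integrable (fun u => lam p (t * u)) (gaussianReal 0 1) :=
    ((polyGrowth_lam hp).comp_mul t).integrable
      ((continuous_lam hp).comp (continuous_const.mul continuous_id))
  unfold Psi
  simp only [e, muP_two]
  rw [eIntegral_coe (f := fun u => lam p (t * u) - Real.log a) (hi.sub (integrable_const _)),
    integral_sub hi (integrable_const _), kappa]
  simp

lemma Psi_eq_top {p : ℝ} (hp : 1 < p) (r : ℝ) {c : ℝ} (hc : 1 / p ≤ c) :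
    Psi p (muP 2) (r, c) = ⊤ := by
  unfold Psi
  simp only [LamP_eq_top hp _ hc, muP_two, eIntegral_top]

theorem Iq_eq_rate {p : ℝ} (hp : 1 < p) (w : ℝ) : Iq p (muP 2) w = rate p w := by
  have h0 : 0 < p := by linarith
  refine le_antisymm ?_ ?_
  · refine (iInf₂_le (w, 1) ⟨one_pos, by simp⟩).trans (iSup_le fun ⟨r, c⟩ => ?_)
    rcases le_or_gt (1 / p) c with hc | hc
    · rw [Psi_eq_top hp _ hc]; simp
    · have hpos : 0 < 1 - p * c := by
        rw [lt_div_iff₀ h0] at hc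
        linarith
      set a := (1 - p * c) ^ (1 / p)
      have ha : 0 < a := Real.rpow_pos_of_pos hpos _
      have hap : a ^ p = 1 - p * c := by
        rw [← Real.rpow_mul hpos.le, one_div_mul_cancel h0.ne', Real.rpow_one]
      have hc' : c = 1 / p - a ^ p / p := by rw [hap]; field_simp; ring
      have hr : r = r / a * a := by field_simp
      rw [hc', hr, Psi_scaled hp _ ha, ← EReal.coe_sub]
      refine le_of_eq_of_le ?_ (rateExp_le_rate p w (r / a) ha)
      rw [rateExp]
      congr 1
      ring
  · refine iSup_le fun ⟨t, ⟨a, ha⟩⟩ => le_iInf₂ fun ⟨τ₁, τ₂⟩ ⟨hτ, hw⟩ => ?_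
    simp only at hτ hw
    have ha' : 0 < a * τ₂ ^ (-(1:ℝ)/p) := mul_pos ha (Real.rpow_pos_of_pos hτ _)
    refine le_trans ?_ (le_iSup (fun q : ℝ × ℝ =>
      ((q.1 * τ₁ + q.2 * τ₂ : ℝ) : EReal) - Psi p (muP 2) q)
      (t * (a * τ₂ ^ (-(1:ℝ)/p)), 1 / p - (a * τ₂ ^ (-(1:ℝ)/p)) ^ p / p))
    rw [Psi_scaled hp _ ha', ← EReal.coe_sub, EReal.coe_le_coe_iff]
    have hpow : (τ₂ ^ (-(1:ℝ)/p)) ^ p = τ₂⁻¹ := by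
      rw [← Real.rpow_mul hτ.le, div_mul_cancel₀ _ h0.ne', Real.rpow_neg_one]
    simp only
    rw [rateExp, Real.mul_rpow (le_of_lt ha) (by positivity), hpow,
      Real.log_mul (ne_of_gt ha) (by positivity), Real.log_rpow hτ, ← hw]
    have hlog := Real.log_le_sub_one_of_pos hτ
    have h1 : (1 / p - a ^ p * τ₂⁻¹ / p) * τ₂ = τ₂ / p - a ^ p / p := by field_simp
    rw [h1]
    have h2 : Real.log τ₂ / p ≤ (τ₂ - 1) / p := by gcongr
    have h3 : -1 / p * Real.log τ₂ = -(Real.log τ₂ / p) := by ring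
    have h4 : (τ₂ - 1) / p = τ₂ / p - 1 / p := by ring
    have h5 : (1 - a ^ p) / p = 1 / p - a ^ p / p := by ring
    rw [h3, h5]
    linarith

/-! ### Elementary properties of the rate function -/

lemma rate_nonneg {p : ℝ} (hp : 1 < p) (w : ℝ) : 0 ≤ rate p w := by
  refine le_of_eq_of_le ?_ (rateExp_le_rate p w 0 one_pos)
  simp [rateExp, kappa_zero hp]

lemma lowerSemicontinuous_rate (p : ℝ) : LowerSemicontinuous (rate p) := by
  refine lowerSemicontinuous_iSup fun q => Continuous.lowerSemicontinuous ?_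
  unfold rateExp
  exact continuous_coe_real_ereal.comp (by fun_prop)

lemma hasCompactSublevels_rate (p : ℝ) : HasCompactSublevels (rate p) := by
  intro c
  refine (isCompact_Icc (a := -(c + kappa p 1)) (b := c + kappa p 1)).of_isClosed_subset
    ((lowerSemicontinuous_rate p).isClosed_preimage _) fun w hw => ?_
  have h1 := (rateExp_le_rate p w 1 one_pos).trans hw
  have h2 := (rateExp_le_rate p w (-1) one_pos).trans hw
  rw [EReal.coe_le_coe_iff] at h1 h2
  simp only [rateExp, kappa_neg, Real.one_rpow, Real.log_one, sub_self, zero_div] at h1 h2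
  constructor <;> linarith

lemma quasiconvexRate_rate (p : ℝ) : QuasiconvexRate (rate p) := by
  intro c
  have e : {x | rate p x ≤ c} =
      ⋂ q : ℝ × Ioi (0 : ℝ), {x | ((rateExp p x q.1 q.2 : ℝ) : EReal) ≤ c} := by
    ext x; simp [rate, iSup_le_iff]
  rw [e]
  refine convex_iInter fun q => ?_
  refine OrdConnected.convex ⟨fun x hx y hy z hz => ?_⟩
  rw [mem_ofPred_eq] at *
  have hmax : rateExp p z q.1 q.2 ≤ max (rateExp p x q.1 q.2) (rateExp p y q.1 q.2) := by
    rw [le_max_iff]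
    unfold rateExp
    rcases le_total 0 (q.1 * q.2) with h | h
    · right
      nlinarith [mul_le_mul_of_nonneg_left hz.2 h]
    · left
      nlinarith [mul_le_mul_of_nonpos_left hz.1 h]
  refine (EReal.coe_le_coe_iff.2 hmax).trans ?_
  rcases max_choice (rateExp p x q.1 q.2) (rateExp p y q.1 q.2) with h | h <;> rwa [h]

lemma symmetricRate_rate (p : ℝ) : SymmetricRate (rate p) := by
  have key : ∀ w, rate p (-w) ≤ rate p w := fun w => iSup_le fun ⟨t, ⟨a, ha⟩⟩ => by
    refine le_of_eq_of_le ?_ (rateExp_le_rate p w (-t) ha)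
    simp only [rateExp, kappa_neg]
    congr 1
    ring
  intro w
  refine le_antisymm (key w) ?_
  simpa using key (-w)

/-! ### Product densities and volumes -/

lemma pi_withDensity_ofReal {n : ℕ} {f : Fin n → ℝ → ℝ} (hf : ∀ i y, 0 ≤ f i y)
    (hi : ∀ i, Integrable (f i)) :
    (Measure.pi fun i => volume.withDensity fun y => ENNReal.ofReal (f i y)) =
      volume.withDensity fun y : Fin n → ℝ => ENNReal.ofReal (∏ i, f i (y i)) := by
  have : ∀ i, SigmaFinite (volume.withDensity fun y => ENNReal.ofReal (f i y)) := fun i => by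
    have := isFiniteMeasure_withDensity_ofReal (hi i).2
    infer_instance
  refine Measure.pi_eq fun s hs => ?_
  have hi' : ∀ i, Integrable ((s i).indicator (f i)) := fun i => (hi i).indicator (hs i)
  have hf' : ∀ i y, 0 ≤ (s i).indicator (f i) y := fun i y => indicator_nonneg (fun y _ => hf i y) y
  have e1 : ∀ i, volume.withDensity (fun y => ENNReal.ofReal (f i y)) (s i) =
      ENNReal.ofReal (∫ y, (s i).indicator (f i) y) := fun i => by
    rw [ofReal_integral_eq_lintegral_ofReal (hi' i) (Eventually.of_forall (hf' i)),
      withDensity_apply _ (hs i), ← lintegral_indicator (hs i)]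
    refine lintegral_congr fun y => ?_
    by_cases hy : y ∈ s i <;> simp [hy]
  rw [withDensity_apply _ (MeasurableSet.univ_pi hs),
    ← lintegral_indicator (MeasurableSet.univ_pi hs), Finset.prod_congr rfl fun i _ => e1 i,
    ← ENNReal.ofReal_prod_of_nonneg fun i _ => integral_nonneg (hf' i),
    ← integral_fintype_prod_volume_eq_prod,
    ofReal_integral_eq_lintegral_ofReal (by rw [volume_pi]; exact Integrable.fintype_prod_dep hi')
      (Eventually.of_forall fun y => Finset.prod_nonneg fun i _ => hf' i _)]
  refine lintegral_congr fun y => ?_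
  by_cases hy : y ∈ univ.pi s
  · rw [indicator_of_mem hy]
    congr 1
    refine Finset.prod_congr rfl fun i _ => ?_
    rw [indicator_of_mem (hy i trivial)]
  · rw [indicator_of_notMem hy]
    obtain ⟨i, hi⟩ : ∃ i, y i ∉ s i := by simpa using hy
    rw [Finset.prod_eq_zero (Finset.mem_univ i) (indicator_of_notMem hi _), ENNReal.ofReal_zero]

/-- The Lebesgue density of the tilted distribution. -/
def tiltDensity (p r y : ℝ) : ℝ :=
  (normP p)⁻¹ * Real.exp (r * y - |y| ^ p / p - lam p r)

lemma tiltDensity_nonneg {p : ℝ} (hp : 1 < p) (r y : ℝ) : 0 ≤ tiltDensity p r y :=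
  mul_nonneg (inv_pos.2 (normP_pos hp)).le (Real.exp_pos _).le

lemma integrable_tiltDensity {p : ℝ} (hp : 1 < p) (r : ℝ) : Integrable (tiltDensity p r) := by
  refine (((integrable_muP_iff hp _).1 (integrable_exp_mul_muP hp r)).const_mul
    ((normP p)⁻¹ * Real.exp (-lam p r))).congr (Eventually.of_forall fun y => ?_)
  simp only [tiltDensity]
  rw [mul_assoc, ← Real.exp_add, ← Real.exp_add]
  congr 2
  ring

lemma tilt_eq_withDensity {p : ℝ} (hp : 1 < p) (r : ℝ) :
    tilt p r = volume.withDensity fun y => ENNReal.ofReal (tiltDensity p r y) := by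
  have hN : 0 < 2 * p ^ (1 / p) * Real.Gamma (1 + 1 / p) := normP_pos hp
  rw [tilt, Measure.tilted, muP, ← withDensity_mul _ (muP_density_measurable p) (by fun_prop)]
  congr 1
  funext y
  rw [Pi.mul_apply, ← muP, ← exp_lam hp, ← ENNReal.ofReal_mul
    (mul_nonneg (inv_pos.2 hN).le (Real.exp_pos _).le), tiltDensity, ← Real.exp_sub,
    mul_assoc, ← Real.exp_add, normP]
  congr 3
  ring

/-- The normalized inner product of `u` and `y`. -/
def wavg {n : ℕ} (u y : Fin n → ℝ) : ℝ := (n : ℝ)⁻¹ * ∑ i, u i * y i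

/-- The Lebesgue density of the product of tilted distributions. -/
def prodDensity (p t : ℝ) {n : ℕ} (u y : Fin n → ℝ) : ℝ :=
  (normP p ^ n)⁻¹ * Real.exp (n * (t * wavg u y - avg (fun x => |x| ^ p) y / p -
    avg (fun x => lam p (t * x)) u))

lemma prod_tiltDensity (p t : ℝ) {n : ℕ} (u y : Fin n → ℝ) :
    ∏ i, tiltDensity p (t * u i) (y i) = prodDensity p t u y := by
  rcases Nat.eq_zero_or_pos n with rfl | hn
  · simp [prodDensity]
  have hn' : (n : ℝ) ≠ 0 := by positivity
  simp only [tiltDensity, Finset.prod_mul_distrib, Finset.prod_const, Finset.card_univ,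
    Fintype.card_fin, prodDensity, inv_pow, ← Real.exp_sum, Finset.sum_sub_distrib, wavg, avg,
    ← Finset.sum_div, mul_assoc, ← Finset.mul_sum]
  congr 2
  field_simp

/-- The product of tilted distributions. -/
def prodTilt (p t : ℝ) {n : ℕ} (u : Fin n → ℝ) : Measure (Fin n → ℝ) :=
  Measure.pi fun i => tilt p (t * u i)

lemma isProbabilityMeasure_prodTilt {p : ℝ} (hp : 1 < p) (t : ℝ) {n : ℕ} (u : Fin n → ℝ) :
    IsProbabilityMeasure (prodTilt p t u) := by
  have := isProbabilityMeasure_tilt hp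
  unfold prodTilt
  infer_instance

lemma prodTilt_eq_withDensity {p : ℝ} (hp : 1 < p) (t : ℝ) {n : ℕ} (u : Fin n → ℝ) :
    prodTilt p t u = volume.withDensity fun y => ENNReal.ofReal (prodDensity p t u y) := by
  simp only [prodTilt, tilt_eq_withDensity hp, ← prod_tiltDensity]
  exact pi_withDensity_ofReal (fun i => tiltDensity_nonneg hp _)
    fun i => integrable_tiltDensity hp _

lemma volume_le_of_prodDensity_ge {p : ℝ} (hp : 1 < p) (t : ℝ) {n : ℕ} (u : Fin n → ℝ)
    {A : Set (Fin n → ℝ)} (hA : MeasurableSet A) {c : ℝ} (hc : 0 < c)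
    (h : ∀ y ∈ A, c ≤ prodDensity p t u y) : volume A ≤ ENNReal.ofReal c⁻¹ := by
  have := isProbabilityMeasure_prodTilt hp t u
  have h1 : ENNReal.ofReal c * volume A ≤ 1 := by
    refine le_trans ?_ (prob_le_one (μ := prodTilt p t u) (s := A))
    rw [prodTilt_eq_withDensity hp, withDensity_apply _ hA, ← setLIntegral_const]
    exact setLIntegral_mono' hA fun y hy => ENNReal.ofReal_le_ofReal (h y hy)
  rw [ENNReal.ofReal_inv_of_pos hc]
  rwa [mul_comm, ← ENNReal.le_inv_iff_mul_le] at h1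

lemma prodTilt_le_of_prodDensity_le {p : ℝ} (hp : 1 < p) (t : ℝ) {n : ℕ} (u : Fin n → ℝ)
    {A : Set (Fin n → ℝ)} (hA : MeasurableSet A) {c : ℝ}
    (h : ∀ y ∈ A, prodDensity p t u y ≤ c) : prodTilt p t u A ≤ ENNReal.ofReal c * volume A := by
  rw [prodTilt_eq_withDensity hp, withDensity_apply _ hA, ← setLIntegral_const]
  exact setLIntegral_mono' hA fun y hy => ENNReal.ofReal_le_ofReal (h y hy)

lemma measurable_wavg {n : ℕ} (u : Fin n → ℝ) : Measurable (wavg u) := by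
  unfold wavg; fun_prop

lemma wavg_smul {n : ℕ} (u y : Fin n → ℝ) (b : ℝ) : wavg u (b • y) = b * wavg u y := by
  simp only [wavg, Pi.smul_apply, smul_eq_mul, Finset.mul_sum]
  refine Finset.sum_congr rfl fun i _ => by ring

lemma avg_abs_rpow_smul (p : ℝ) {n : ℕ} (y : Fin n → ℝ) {b : ℝ} (hb : 0 ≤ b) :
    avg (fun x => |x| ^ p) (b • y) = b ^ p * avg (fun x => |x| ^ p) y := by
  simp only [avg, Pi.smul_apply, smul_eq_mul, Finset.mul_sum, abs_mul, abs_of_nonneg hb]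
  refine Finset.sum_congr rfl fun i _ => ?_
  rw [Real.mul_rpow hb (abs_nonneg _)]
  ring

lemma volume_preimage_smul {n : ℕ} {b : ℝ} (hb : 0 < b) (s : Set (Fin n → ℝ)) :
    volume ((b • ·) ⁻¹' s) = ENNReal.ofReal (b ^ n)⁻¹ * volume s := by
  rw [Measure.addHaar_preimage_smul _ hb.ne', abs_of_pos (by positivity)]
  simp

/-- The volume of the part of the normalized `ℓ^p` ball whose projection lies in `S`. -/
def ballVol (p : ℝ) {n : ℕ} (u : Fin n → ℝ) (S : Set ℝ) : ℝ≥0∞ :=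
  volume {y : Fin n → ℝ | avg (fun x => |x| ^ p) y ≤ 1 ∧ wavg u y ∈ S}

lemma ballVol_mono (p : ℝ) {n : ℕ} (u : Fin n → ℝ) {S T : Set ℝ} (h : S ⊆ T) :
    ballVol p u S ≤ ballVol p u T :=
  measure_mono fun _ hy => ⟨hy.1, h hy.2⟩

lemma ballVol_halfspace_le {p : ℝ} (hp : 1 < p) {n : ℕ} (u : Fin n → ℝ)
    (w t : ℝ) {a : ℝ} (ha : 0 < a) :
    ballVol p u {y | t * w ≤ t * y} ≤ ENNReal.ofReal (normP p ^ n * Real.exp (n *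
      (1 / p - rateExp p w t a + (avg (fun x => lam p (t * x)) u - kappa p t)))) := by
  have hN := normP_pos hp
  have h0 : 0 < p := by linarith
  set A : Set (Fin n → ℝ) := {y | avg (fun x => |x| ^ p) y ≤ 1 ∧ t * w ≤ t * wavg u y}
  have hA : MeasurableSet A :=
    (measurableSet_le (measurable_avg (by fun_prop)) measurable_const).inter
      (measurableSet_le measurable_const ((measurable_wavg u).const_mul t))
  set L := avg (fun x => lam p (t * x)) u
  have hm : MeasurableSet ((a⁻¹ • ·) ⁻¹' A : Set (Fin n → ℝ)) :=
    measurable_const_smul a⁻¹ hA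
  have key := volume_le_of_prodDensity_ge hp t u hm
    (c := (normP p ^ n)⁻¹ * Real.exp (n * (t * a * w - a ^ p / p - L))) (by positivity) ?_
  · rw [volume_preimage_smul (inv_pos.2 ha)] at key
    have e : ballVol p u {y | t * w ≤ t * y} = volume A := rfl
    have e2 : volume A = ENNReal.ofReal ((a ^ n)⁻¹) *
        (ENNReal.ofReal (((a⁻¹) ^ n)⁻¹) * volume A) := by
      rw [← mul_assoc, ← ENNReal.ofReal_mul (by positivity)]
      have : (a ^ n)⁻¹ * ((a⁻¹) ^ n)⁻¹ = 1 := by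
        rw [inv_pow, inv_inv, inv_mul_cancel₀ (by positivity)]
      rw [this, ENNReal.ofReal_one, one_mul]
    rw [e, e2]
    refine (mul_le_mul_right key _).trans ?_
    rw [← ENNReal.ofReal_mul (by positivity)]
    refine ENNReal.ofReal_le_ofReal (le_of_eq ?_)
    rw [mul_inv, inv_inv, ← Real.exp_neg]
    have h3 : (a ^ n)⁻¹ = Real.exp (n * (-Real.log a)) := by
      rw [mul_neg, Real.exp_neg, Real.exp_nat_mul, Real.exp_log ha]
    rw [h3, mul_left_comm, ← Real.exp_add]
    congr 2
    unfold rateExp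
    ring
  · rintro y ⟨hy1, hy2⟩
    rw [avg_abs_rpow_smul _ _ (inv_pos.2 ha).le, Real.inv_rpow ha.le,
      inv_mul_le_iff₀ (by positivity), mul_one] at hy1
    rw [wavg_smul] at hy2
    have hy3 : t * a * w ≤ t * wavg u y := by
      have := mul_le_mul_of_nonneg_left hy2 ha.le
      have e : a * (t * (a⁻¹ * wavg u y)) = t * wavg u y := by field_simp
      rw [e] at this
      linarith
    unfold prodDensity
    gcongr

/-! ### Concentration under the product of tilted distributions -/

lemma prodTilt_deviation_le {p s : ℝ} (hp : 1 < p) (hs : 0 ≤ s) (t : ℝ) {n : ℕ}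
    (u : Fin n → ℝ) (c : ℝ → ℝ) {f : ℝ → ℝ} (hf : Continuous f) (h : ∀ y, |f y| ≤ |y| ^ s)
    {δ : ℝ} (hδ : 0 < δ) :
    prodTilt p t u {y | δ ≤ |(n : ℝ)⁻¹ * ∑ i, c (u i) * f (y i) -
      avg (fun x => c x * ∫ y, f y ∂(tilt p (t * x))) u|} ≤
    ENNReal.ofReal ((n : ℝ)⁻¹ *
      avg (fun x => c x ^ 2 * (cut p (t * x) ^ (2 * s) + momConst p (2 * s))) u / δ ^ 2) := by
  have hP := isProbabilityMeasure_tilt hp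
  have hPP := isProbabilityMeasure_prodTilt hp t u
  have hf2 : Continuous fun y => f y ^ 2 := hf.pow 2
  have h2 : ∀ y, |f y ^ 2| ≤ |y| ^ (2 * s) := fun y => by
    rw [abs_pow, mul_comm 2 s, Real.rpow_mul (abs_nonneg y)]
    exact_mod_cast pow_le_pow_left₀ (abs_nonneg _) (h y) 2
  have hi : ∀ r, Integrable f (tilt p r) := integrable_tilt hp hs hf h
  have hi2 : ∀ r, Integrable (fun y => f y ^ 2) (tilt p r) :=
    integrable_tilt hp (by positivity) hf2 h2
  have hL : ∀ r a, MemLp (fun y => a * f y) 2 (tilt p r) := fun r a =>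
    ((memLp_two_iff_integrable_sq hf.aestronglyMeasurable).2 (hi2 r)).const_mul a
  have hsum : MemLp (∑ i, fun y : Fin n → ℝ => c (u i) * f (y i)) 2 (prodTilt p t u) :=
    memLp_finsetSum' _ fun i _ =>
      (hL (t * u i) (c (u i))).comp_measurePreserving (measurePreserving_eval _ i)
  have hX : MemLp (fun y : Fin n → ℝ => (n : ℝ)⁻¹ * ∑ i, c (u i) * f (y i)) 2
      (prodTilt p t u) := by
    have := hsum.const_mul (n : ℝ)⁻¹
    simpa only [Finset.sum_apply] using this
  have hmean : ∫ y, (n : ℝ)⁻¹ * ∑ i, c (u i) * f (y i) ∂(prodTilt p t u) =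
      avg (fun x => c x * ∫ y, f y ∂(tilt p (t * x))) u := by
    rw [integral_const_mul, integral_finsetSum, avg]
    · congr 1
      refine Finset.sum_congr rfl fun i _ => ?_
      rw [integral_const_mul]
      congr 1
      exact integral_comp_eval (μ := fun i => tilt p (t * u i)) (i := i) hf.aestronglyMeasurable
    · intro i _
      exact integrable_comp_eval (μ := fun i => tilt p (t * u i)) (i := i)
        ((hi (t * u i)).const_mul (c (u i)))
  have hvar : Var[fun y : Fin n → ℝ => (n : ℝ)⁻¹ * ∑ i, c (u i) * f (y i); prodTilt p t u] ≤
      (n : ℝ)⁻¹ * avg (fun x => c x ^ 2 * (cut p (t * x) ^ (2 * s) + momConst p (2 * s))) u := by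
    have e := variance_sum_pi (μ := fun i => tilt p (t * u i))
      (X := fun i y => c (u i) * f y) fun i => hL _ _
    have e' : Var[fun y : Fin n → ℝ => ∑ i, c (u i) * f (y i); prodTilt p t u] =
        ∑ i, Var[fun y => c (u i) * f y; tilt p (t * u i)] := by
      rw [← e, prodTilt]
      congr 1
      ext y
      simp
    rw [variance_const_mul, e', avg, ← mul_assoc, ← sq]
    refine mul_le_mul_of_nonneg_left (Finset.sum_le_sum fun i _ => ?_) (by positivity)
    rw [variance_const_mul]
    refine mul_le_mul_of_nonneg_left ?_ (by positivity)
    refine (variance_le_expectation_sq hf.aestronglyMeasurable).trans ?_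
    refine le_trans ?_ (integral_tilt_abs_rpow_le hp (by positivity : 0 ≤ 2 * s) (t * u i))
    refine integral_mono (hi2 _) ?_ fun y => (le_abs_self _).trans (h2 y)
    exact integrable_tilt (s := 2 * s) hp (by positivity) (continuous_abs.rpow_const fun _ => Or.inr
      (by positivity)) (fun y => by rw [abs_of_nonneg (by positivity)]) _
  rw [← hmean]
  refine (meas_ge_le_variance_div_sq hX hδ).trans (ENNReal.ofReal_le_ofReal ?_)
  gcongr

lemma GoodArray.tendsto_prodTilt_deviation {p s : ℝ} (hp : 1 < p) (hs : 0 ≤ s)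
    {u : (n : ℕ) → Fin n → ℝ} (hu : GoodArray u) (t : ℝ) {c : ℝ → ℝ} (hc : Continuous c)
    (hcg : PolyGrowth c) {f : ℝ → ℝ} (hf : Continuous f) (h : ∀ y, |f y| ≤ |y| ^ s) {m : ℝ}
    (hm : Tendsto (fun n => avg (fun x => c x * ∫ y, f y ∂(tilt p (t * x))) (u n)) atTop (𝓝 m))
    {δ : ℝ} (hδ : 0 < δ) :
    Tendsto (fun n : ℕ => prodTilt p t (u n)
      {y | δ ≤ |(n : ℝ)⁻¹ * ∑ i, c (u n i) * f (y i) - m|}) atTop (𝓝 0) := by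
  have hcut := (continuous_cut hp).comp (continuous_const_mul t)
  have hbound := hu.tendsto (f := fun x => c x ^ 2 *
      (cut p (t * x) ^ (2 * s) + momConst p (2 * s)))
    ((hc.pow 2).mul ((hcut.rpow_const fun x => Or.inr (by positivity)).add continuous_const)) (by
      simp only [sq]
      exact (hcg.mul hcg).mul (((polyGrowth_cut_rpow hp (2 * s)).comp_mul t).add
        (polyGrowth_const _)))
  have hlim : Tendsto (fun n : ℕ => ENNReal.ofReal ((n : ℝ)⁻¹ *
      avg (fun x => c x ^ 2 * (cut p (t * x) ^ (2 * s) + momConst p (2 * s))) (u n) /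
        (δ / 2) ^ 2)) atTop (𝓝 0) := by
    rw [← ENNReal.ofReal_zero]
    refine ENNReal.tendsto_ofReal ?_
    simpa using ((tendsto_inv_atTop_nhds_zero_nat (𝕜 := ℝ)).mul hbound).div_const ((δ / 2) ^ 2)
  refine tendsto_of_tendsto_of_tendsto_of_le_of_le' tendsto_const_nhds hlim
    (Eventually.of_forall fun n => zero_le) ?_
  filter_upwards [Metric.tendsto_nhds.1 hm (δ / 2) (by positivity)] with n hn
  refine le_trans (measure_mono fun y hy => ?_)
    (prodTilt_deviation_le hp hs t (u n) c hf h (half_pos hδ))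
  rw [mem_ofPred_eq] at hy ⊢
  rw [Real.dist_eq] at hn
  have := abs_sub_le ((n : ℝ)⁻¹ * ∑ i, c (u n i) * f (y i))
    (avg (fun x => c x * ∫ y, f y ∂(tilt p (t * x))) (u n)) m
  linarith

/-- The tilted typical set: the normalized projection is close to `kappaDeriv p t` and the
normalized `ℓ^p` norm is close to its tilted expectation. -/
def typicalSet (p t δ : ℝ) {n : ℕ} (u : Fin n → ℝ) : Set (Fin n → ℝ) :=
  {y | |wavg u y - kappaDeriv p t| < δ ∧ |avg (fun x => |x| ^ p) y - radius p t ^ p| < δ}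

lemma measurableSet_typicalSet (p t δ : ℝ) {n : ℕ} (u : Fin n → ℝ) :
    MeasurableSet (typicalSet p t δ u) := by
  have h1 := measurable_wavg u
  have h2 : Measurable fun y : Fin n → ℝ => avg (fun x => |x| ^ p) y :=
    measurable_avg (by fun_prop)
  exact (measurableSet_lt (h1.sub_const _).abs measurable_const).inter
    (measurableSet_lt (h2.sub_const _).abs measurable_const)

lemma GoodArray.eventually_typicalSet {p : ℝ} (hp : 1 < p) {u : (n : ℕ) → Fin n → ℝ}
    (hu : GoodArray u) (t : ℝ) {δ : ℝ} (hδ : 0 < δ) :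
    ∀ᶠ n in atTop, 2⁻¹ ≤ prodTilt p t (u n) (typicalSet p t δ (u n)) := by
  have h0 : 0 < p := by linarith
  have h1 := hu.tendsto_prodTilt_deviation hp zero_le_one t continuous_id polyGrowth_id
    (f := fun y => y) continuous_id (fun y => by simp) (m := kappaDeriv p t)
    (hu.tendsto_kappaDeriv hp t) hδ
  have hm : Tendsto (fun n => avg (fun x => (fun _ => (1 : ℝ)) x *
      ∫ y, (fun y => |y| ^ p) y ∂(tilt p (t * x))) (u n)) atTop (𝓝 (radius p t ^ p)) := by
    rw [radius_rpow hp]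
    refine Tendsto.congr' ?_ (((hu.tendsto_kappaDeriv hp t).const_mul t).const_add 1)
    filter_upwards [eventually_gt_atTop 0] with n hn
    simp only [integral_tilt_abs_rpow hp, one_mul]
    rw [avg_add (fun _ => 1), avg_const hn, ← avg_const_mul]
    simp only [mul_assoc]
  have h2 := hu.tendsto_prodTilt_deviation hp h0.le t (c := fun _ => 1) continuous_const
    (polyGrowth_const 1) (f := fun y => |y| ^ p) (continuous_abs.rpow_const fun _ => Or.inr h0.le)
    (fun y => by rw [abs_of_nonneg (by positivity)]) hm hδ
  have h3 := h1.add h2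
  rw [add_zero] at h3
  filter_upwards [h3.eventually_le_const (u := 2⁻¹) (by simp)] with n hn
  have hPP := isProbabilityMeasure_prodTilt hp t (u n)
  have hc : prodTilt p t (u n) (typicalSet p t δ (u n))ᶜ ≤ 2⁻¹ := by
    refine le_trans (measure_mono fun y hy => ?_) ((measure_union_le _ _).trans hn)
    rw [typicalSet, mem_compl_iff, mem_ofPred_eq, not_and_or, not_lt, not_lt] at hy
    rcases hy with hy | hy
    · exact Or.inl hy
    · right
      simpa only [one_mul, mem_ofPred_eq, avg] using hy
  have := prob_compl_eq_one_sub (μ := prodTilt p t (u n)) (measurableSet_typicalSet p t δ (u n))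
  rw [this, tsub_le_iff_right] at hc
  have h5 : (2 : ℝ≥0∞)⁻¹ + 2⁻¹ ≤ 2⁻¹ + prodTilt p t (u n) (typicalSet p t δ (u n)) := by
    rwa [ENNReal.inv_two_add_inv_two]
  exact (ENNReal.add_le_add_iff_left (by simp)).1 h5

/-- The almost sure limit of the normalized projection under tilting. -/
def tiltedLimit (p t : ℝ) : ℝ := kappaDeriv p t / radius p t

lemma exists_typical_radius {p : ℝ} (hp : 1 < p) (t : ℝ) {ε η : ℝ} (hε : 0 < ε) (hη : 0 < η) :
    ∃ δ b : ℝ, 0 < δ ∧ 0 < b ∧ b ^ p * (radius p t ^ p + δ) ≤ 1 ∧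
      b * δ + |b * kappaDeriv p t - tiltedLimit p t| < ε ∧
      -Real.log (radius p t) - η < Real.log b - |t| * δ - δ / p := by
  have h0 : 0 < p := by linarith
  have hR : 0 < radius p t := by linarith [one_le_radius hp t]
  set R := radius p t
  set k := kappaDeriv p t
  set b : ℝ → ℝ := fun δ => (R ^ p + δ) ^ (-(1 / p))
  have hRp : 0 < R ^ p := Real.rpow_pos_of_pos hR _
  have hb0 : b 0 = R⁻¹ := by
    simp only [b, add_zero]
    rw [← Real.rpow_mul hR.le, mul_neg, mul_one_div_cancel h0.ne', Real.rpow_neg_one]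
  have hbc : ContinuousAt b 0 := by
    refine ContinuousAt.rpow_const (by fun_prop) (Or.inl ?_)
    simpa using hRp.ne'
  have h1 : ∀ᶠ δ in 𝓝 (0 : ℝ), b δ * δ + |b δ * k - tiltedLimit p t| < ε := by
    have hc : ContinuousAt (fun δ => b δ * δ + |b δ * k - tiltedLimit p t|) 0 := by fun_prop
    refine hc.eventually_lt continuousAt_const ?_
    have e : R⁻¹ * k - tiltedLimit p t = 0 := by
      rw [tiltedLimit, div_eq_inv_mul, sub_self]
    simpa [hb0, e] using hε
  have h2 : ∀ᶠ δ in 𝓝 (0 : ℝ),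
      -Real.log R - η < Real.log (b δ) - |t| * δ - δ / p := by
    have hl : ContinuousAt (fun δ => Real.log (b δ)) 0 :=
      hbc.log (by rw [hb0]; exact inv_ne_zero hR.ne')
    have hc : ContinuousAt (fun δ => Real.log (b δ) - |t| * δ - δ / p) 0 := by fun_prop
    refine continuousAt_const.eventually_lt hc ?_
    simpa [hb0] using hη
  obtain ⟨δ, ⟨h1, h2⟩, hδ⟩ := (((h1.and h2).filter_mono nhdsWithin_le_nhds).and
    (self_mem_nhdsWithin : ∀ᶠ δ in 𝓝[>] (0 : ℝ), δ ∈ Ioi 0)).exists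
  refine ⟨δ, b δ, hδ, Real.rpow_pos_of_pos (by positivity) _, le_of_eq ?_, h1, h2⟩
  simp only [b]
  rw [← Real.rpow_mul (by positivity), neg_mul, one_div_mul_cancel h0.ne', Real.rpow_neg_one,
    inv_mul_cancel₀ (by positivity)]

lemma volume_typicalSet_le {p : ℝ} (t : ℝ) {n : ℕ} (u : Fin n → ℝ) {δ b ε : ℝ}
    (hb : 0 < b) (h1 : b ^ p * (radius p t ^ p + δ) ≤ 1)
    (h2 : b * δ + |b * kappaDeriv p t - tiltedLimit p t| < ε) :
    volume (typicalSet p t δ u) ≤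
      ENNReal.ofReal (b ^ n)⁻¹ * ballVol p u (Metric.ball (tiltedLimit p t) ε) := by
  rw [ballVol, ← volume_preimage_smul hb]
  refine measure_mono fun y hy => ?_
  obtain ⟨hy1, hy2⟩ := hy
  refine ⟨?_, ?_⟩
  · rw [avg_abs_rpow_smul _ _ hb.le]
    refine le_trans ?_ h1
    have := (abs_lt.1 hy2).2
    gcongr
    linarith
  · rw [wavg_smul, Metric.mem_ball, Real.dist_eq]
    have e : b * wavg u y - tiltedLimit p t =
        b * (wavg u y - kappaDeriv p t) + (b * kappaDeriv p t - tiltedLimit p t) := by ring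
    rw [e]
    refine (abs_add_le _ _).trans_lt (lt_of_le_of_lt ?_ h2)
    rw [abs_mul, abs_of_pos hb]
    gcongr

lemma prodDensity_le_of_mem_typicalSet {p : ℝ} (hp : 1 < p) (t : ℝ) {n : ℕ} (u : Fin n → ℝ)
    {δ : ℝ} {y : Fin n → ℝ} (hy : y ∈ typicalSet p t δ u) :
    prodDensity p t u y ≤ (normP p ^ n)⁻¹ * Real.exp (n * (t * kappaDeriv p t + |t| * δ -
      (radius p t ^ p - δ) / p - avg (fun x => lam p (t * x)) u)) := by
  have hN := normP_pos hp
  have h0 : 0 < p := by linarith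
  obtain ⟨hy1, hy2⟩ := hy
  have h1 : t * wavg u y ≤ t * kappaDeriv p t + |t| * δ := by
    have h3 : t * (wavg u y - kappaDeriv p t) ≤ |t| * δ := by
      refine (le_abs_self _).trans ?_
      rw [abs_mul]
      gcongr
    linarith
  have h2 := (abs_lt.1 hy2).1
  have h4 : (radius p t ^ p - δ) / p ≤ avg (fun x => |x| ^ p) y / p := by
    gcongr
    linarith
  unfold prodDensity
  gcongr

lemma GoodArray.eventually_le_ballVol {p : ℝ} (hp : 1 < p) {u : (n : ℕ) → Fin n → ℝ}
    (hu : GoodArray u) (t : ℝ) {ε η : ℝ} (hε : 0 < ε) (hη : 0 < η) :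
    ∀ᶠ n : ℕ in atTop, ENNReal.ofReal (normP p ^ n * Real.exp (n *
        (1 / p - rateExp p (tiltedLimit p t) t (radius p t) - η))) ≤
      ballVol p (u n) (Metric.ball (tiltedLimit p t) ε) := by
  have hN := normP_pos hp
  have hR : 0 < radius p t := by linarith [one_le_radius hp t]
  obtain ⟨δ, b, hδ, hb, hb1, hb2, hb3⟩ := exists_typical_radius hp t hε (half_pos hη)
  have hlog : Tendsto (fun n : ℕ => Real.log 2 / (n : ℝ)) atTop (𝓝 0) :=
    tendsto_const_div_atTop_nhds_zero_nat _
  filter_upwards [eventually_gt_atTop 0, hu.eventually_typicalSet hp t hδ,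
    (hu.tendsto_kappa hp t).eventually_const_lt (show kappa p t - η / 4 < kappa p t by linarith),
    hlog.eventually_lt_const (show 0 < η / 4 by linarith)] with n hn hQ hL hl
  have hn' : (0 : ℝ) < n := by exact_mod_cast hn
  set V := ballVol p (u n) (Metric.ball (tiltedLimit p t) ε)
  set L := avg (fun x => lam p (t * x)) (u n)
  set E := t * kappaDeriv p t + |t| * δ - (radius p t ^ p - δ) / p - L
  set c := (normP p ^ n)⁻¹ * Real.exp (n * E)
  have hc : 0 < c * (b ^ n)⁻¹ := by positivity
  have h1 : 2⁻¹ ≤ ENNReal.ofReal (c * (b ^ n)⁻¹) * V := by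
    refine (hQ.trans (prodTilt_le_of_prodDensity_le hp t (u n) (measurableSet_typicalSet p t δ _)
      fun y hy => prodDensity_le_of_mem_typicalSet hp t (u n) hy)).trans ?_
    rw [ENNReal.ofReal_mul (p := c) (by positivity), mul_assoc (ENNReal.ofReal c)]
    exact mul_le_mul_right (volume_typicalSet_le t (u n) hb hb1 hb2) _
  refine (ENNReal.mul_le_mul_iff_right (a := ENNReal.ofReal (c * (b ^ n)⁻¹))
    (by simpa using hc) ENNReal.ofReal_ne_top).1 (le_trans ?_ h1)
  rw [← ENNReal.ofReal_mul hc.le]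
  have e2 : (2 : ℝ≥0∞)⁻¹ = ENNReal.ofReal (Real.exp (-Real.log 2)) := by
    rw [Real.exp_neg, Real.exp_log two_pos, ENNReal.ofReal_inv_of_pos two_pos]
    simp
  rw [e2]
  refine ENNReal.ofReal_le_ofReal ?_
  have h3 : (b ^ n)⁻¹ = Real.exp (n * (-Real.log b)) := by
    rw [mul_neg, Real.exp_neg, Real.exp_nat_mul, Real.exp_log hb]
  set F := 1 / p - rateExp p (tiltedLimit p t) t (radius p t) - η
  have e4 : c * (b ^ n)⁻¹ * (normP p ^ n * Real.exp (n * F)) =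
      Real.exp (n * (E - Real.log b + F)) := by
    rw [h3]
    simp only [c]
    rw [show n * (E - Real.log b + F) = n * E + n * (-Real.log b) + n * F by ring, Real.exp_add,
      Real.exp_add]
    field_simp
  rw [e4]
  refine Real.exp_le_exp.2 ?_
  have h5 : t * radius p t * tiltedLimit p t = t * kappaDeriv p t := by
    rw [tiltedLimit]; field_simp
  have h6 : E - Real.log b + F ≤ -(Real.log 2 / n) := by
    simp only [E, F, rateExp, h5]
    have h7 : (radius p t ^ p - δ) / p = radius p t ^ p / p - δ / p := by ring
    have h8 : (1 - radius p t ^ p) / p = 1 / p - radius p t ^ p / p := by ring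
    rw [h7, h8]
    linarith
  calc n * (E - Real.log b + F) ≤ n * -(Real.log 2 / n) := by gcongr
    _ = -Real.log 2 := by field_simp

/-! ### Exponential estimates for the projected uniform distribution -/

/-- The distribution of the normalized projection of a uniform point of the `ℓ^p` ball. -/
def ballProb (p : ℝ) {n : ℕ} (u : Fin n → ℝ) (S : Set ℝ) : ℝ≥0∞ :=
  (ballVol p u univ)⁻¹ * ballVol p u S

lemma ballProb_mono (p : ℝ) {n : ℕ} (u : Fin n → ℝ) {S T : Set ℝ} (h : S ⊆ T) :
    ballProb p u S ≤ ballProb p u T :=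
  mul_le_mul_right (ballVol_mono p u h) _

lemma ballProb_union_le (p : ℝ) {n : ℕ} (u : Fin n → ℝ) (S T : Set ℝ) :
    ballProb p u (S ∪ T) ≤ ballProb p u S + ballProb p u T := by
  unfold ballProb
  rw [← mul_add]
  refine mul_le_mul_right ((measure_mono fun y hy => ?_).trans (measure_union_le _ _)) _
  exact hy.2.imp (fun h => ⟨hy.1, h⟩) fun h => ⟨hy.1, h⟩

lemma ballProb_le_one (p : ℝ) {n : ℕ} (u : Fin n → ℝ) (S : Set ℝ) : ballProb p u S ≤ 1 :=
  (mul_le_mul_right (ballVol_mono p u (subset_univ S)) _).trans (ENNReal.inv_mul_le_one _)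

lemma measurableSet_lpBall (n : ℕ) {p : ℝ} : MeasurableSet (lpBall n p) :=
  measurableSet_le (by fun_prop) measurable_const

lemma volume_lpBall_inter (p : ℝ) (hp : 1 < p) {n : ℕ} (hn : 0 < n) (θ : Fin n → ℝ)
    (S : Set ℝ) :
    volume (lpBall n p ∩ {x | (n : ℝ) ^ (1/p - 1/2 : ℝ) * dotp x θ ∈ S}) =
      ENNReal.ofReal (((n : ℝ) ^ (1 / p)) ^ n)⁻¹ * ballVol p (fun i => √n * θ i) S := by
  have h0 : 0 < p := by linarith
  have hn' : (0 : ℝ) < n := by exact_mod_cast hn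
  have hc : 0 < (n : ℝ) ^ (1 / p) := Real.rpow_pos_of_pos hn' _
  rw [ballVol, ← volume_preimage_smul hc]
  congr 1
  ext x
  have e1 : avg (fun x => |x| ^ p) ((n : ℝ) ^ (1 / p) • x) = ∑ i, |x i| ^ p := by
    rw [avg_abs_rpow_smul _ _ hc.le, ← Real.rpow_mul hn'.le, one_div_mul_cancel h0.ne',
      Real.rpow_one, avg, mul_inv_cancel_left₀ hn'.ne']
  have e2 : wavg (fun i => √n * θ i) ((n : ℝ) ^ (1 / p) • x) =
      (n : ℝ) ^ (1/p - 1/2 : ℝ) * dotp x θ := by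
    have hs : (n : ℝ) ^ (1/p - 1/2 : ℝ) = (n : ℝ) ^ (1 / p) * ((n : ℝ)⁻¹ * √n) := by
      rw [Real.rpow_sub hn', Real.sqrt_eq_rpow, div_eq_mul_inv]
      congr 1
      rw [← Real.rpow_neg hn'.le, ← Real.rpow_neg_one, ← Real.rpow_add hn']
      norm_num
    rw [wavg_smul, wavg, dotp, hs, mul_assoc, mul_assoc, Finset.mul_sum (a := √n)]
    congr 2
    refine Finset.sum_congr rfl fun i _ => by ring
  simp only [lpBall, mem_inter_iff, mem_ofPred_eq, mem_preimage, e1, e2]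

lemma uniformLpBall_eq_ballProb {p : ℝ} (hp : 1 < p) {n : ℕ} (hn : 0 < n) (θ : Fin n → ℝ)
    (S : Set ℝ) :
    uniformLpBall n p {x | (n : ℝ) ^ (1/p - 1/2 : ℝ) * dotp x θ ∈ S} =
      ballProb p (fun i => √n * θ i) S := by
  have hc : 0 < (((n : ℝ) ^ (1 / p)) ^ n)⁻¹ := by
    have : (0 : ℝ) < n := by exact_mod_cast hn
    positivity
  have h1 := volume_lpBall_inter p hp hn θ univ
  simp only [mem_univ, ofPred_true, inter_univ] at h1
  rw [uniformLpBall, Measure.smul_apply, smul_eq_mul,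
    Measure.restrict_apply' (measurableSet_lpBall n), inter_comm, volume_lpBall_inter p hp hn, h1,
    ballProb, ENNReal.mul_inv (Or.inl (by simpa using hc)) (Or.inl ENNReal.ofReal_ne_top)]
  rw [mul_mul_mul_comm, ENNReal.inv_mul_cancel (by simpa using hc) ENNReal.ofReal_ne_top, one_mul]

lemma radius_zero {p : ℝ} : radius p 0 = 1 := by simp [radius]

lemma rateExp_zero {p : ℝ} (hp : 1 < p) (w : ℝ) : rateExp p w 0 1 = 0 := by
  simp [rateExp, kappa_zero hp]

lemma ofReal_inv_mul_le {V W : ℝ≥0∞} {N A B : ℝ} (hN : 0 < N)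
    (hV : ENNReal.ofReal (N * Real.exp B) ≤ V) (hW : W ≤ ENNReal.ofReal (N * Real.exp A)) :
    V⁻¹ * W ≤ ENNReal.ofReal (Real.exp (A - B)) := by
  refine (mul_le_mul' (ENNReal.inv_le_inv.2 hV) hW).trans (le_of_eq ?_)
  rw [← ENNReal.ofReal_inv_of_pos (by positivity), ← ENNReal.ofReal_mul (by positivity),
    Real.exp_sub]
  congr 1
  field_simp

lemma le_ofReal_inv_mul {V W : ℝ≥0∞} {N A B : ℝ} (hN : 0 < N)
    (hV : V ≤ ENNReal.ofReal (N * Real.exp B)) (hW : ENNReal.ofReal (N * Real.exp A) ≤ W) :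
    ENNReal.ofReal (Real.exp (A - B)) ≤ V⁻¹ * W := by
  refine le_trans (le_of_eq ?_) (mul_le_mul' (ENNReal.inv_le_inv.2 hV) hW)
  rw [← ENNReal.ofReal_inv_of_pos (by positivity), ← ENNReal.ofReal_mul (by positivity),
    Real.exp_sub]
  congr 1
  field_simp

lemma GoodArray.eventually_ballProb_halfspace_le {p : ℝ} (hp : 1 < p)
    {u : (n : ℕ) → Fin n → ℝ} (hu : GoodArray u) (w t : ℝ) {a η : ℝ} (ha : 0 < a) (hη : 0 < η) :
    ∀ᶠ n : ℕ in atTop, ballProb p (u n) {y | t * w ≤ t * y} ≤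
      ENNReal.ofReal (Real.exp (n * (-rateExp p w t a + η))) := by
  filter_upwards [hu.eventually_le_ballVol hp 0 one_pos (half_pos hη),
    (hu.tendsto_kappa hp t).eventually_lt_const (show kappa p t < kappa p t + η / 2 by linarith)]
    with n h1 h2
  rw [radius_zero, rateExp_zero hp, sub_zero] at h1
  refine (ofReal_inv_mul_le (pow_pos (normP_pos hp) n)
    (h1.trans (ballVol_mono p (u n) (subset_univ _)))
    (ballVol_halfspace_le hp (u n) w t ha)).trans (ENNReal.ofReal_le_ofReal ?_)
  rw [← mul_sub]
  gcongr
  linarith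

lemma GoodArray.eventually_le_ballProb_ball {p : ℝ} (hp : 1 < p)
    {u : (n : ℕ) → Fin n → ℝ} (hu : GoodArray u) (t : ℝ) {ε η : ℝ} (hε : 0 < ε) (hη : 0 < η) :
    ∀ᶠ n : ℕ in atTop,
      ENNReal.ofReal (Real.exp (n * (-rateExp p (tiltedLimit p t) t (radius p t) - η))) ≤
        ballProb p (u n) (Metric.ball (tiltedLimit p t) ε) := by
  filter_upwards [hu.eventually_le_ballVol hp t hε hη] with n h1
  have h2 : ballVol p (u n) univ ≤ ENNReal.ofReal (normP p ^ n * Real.exp (n * (1 / p))) := by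
    have h := ballVol_halfspace_le hp (u n) 0 0 one_pos
    simpa [rateExp_zero hp, kappa_zero hp, lam_zero hp, avg] using h
  refine (ENNReal.ofReal_le_ofReal ?_).trans
    (le_ofReal_inv_mul (pow_pos (normP_pos hp) n) h2 h1)
  rw [← mul_sub]
  refine Real.exp_le_exp.2 (le_of_eq ?_)
  ring

/-! ### Attaining the rate function by tilting -/

lemma mean_neg {p : ℝ} (hp : 1 < p) (r : ℝ) : mean p (-r) = -mean p r := by
  rw [mean, mean, integral_tilt hp, integral_tilt hp, lam_neg, ← mul_neg, ← integral_neg,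
    ← integral_comp_neg_muP]
  simp

lemma kappaDeriv_neg {p : ℝ} (hp : 1 < p) (t : ℝ) : kappaDeriv p (-t) = -kappaDeriv p t := by
  rw [kappaDeriv, kappaDeriv, ← integral_neg]
  simp only [neg_mul, mean_neg hp, mul_neg]

lemma radius_neg {p : ℝ} (hp : 1 < p) (t : ℝ) : radius p (-t) = radius p t := by
  rw [radius, radius, kappaDeriv_neg hp, neg_mul_neg]

lemma tiltedLimit_neg {p : ℝ} (hp : 1 < p) (t : ℝ) : tiltedLimit p (-t) = -tiltedLimit p t := by
  rw [tiltedLimit, tiltedLimit, kappaDeriv_neg hp, radius_neg hp, neg_div]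

lemma tiltedLimit_zero {p : ℝ} (hp : 1 < p) : tiltedLimit p 0 = 0 := by
  rw [tiltedLimit, kappaDeriv_zero hp, zero_div]

lemma continuous_tiltedLimit {p : ℝ} (hp : 1 < p) : Continuous (tiltedLimit p) :=
  (continuous_kappaDeriv hp).div (continuous_radius hp) fun t => by
    linarith [one_le_radius hp t]

lemma rateExp_neg_neg (p w t a : ℝ) : rateExp p (-w) (-t) a = rateExp p w t a := by
  simp only [rateExp, kappa_neg]
  ring

lemma rateExp_eq_add (p w x t a : ℝ) :
    rateExp p x t a = rateExp p w t a + t * a * (x - w) := by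
  unfold rateExp
  ring

lemma GoodArray.rateExp_tiltedLimit_nonneg {p : ℝ} (hp : 1 < p) {u : (n : ℕ) → Fin n → ℝ}
    (hu : GoodArray u) (t : ℝ) : 0 ≤ rateExp p (tiltedLimit p t) t (radius p t) := by
  by_contra! h
  set r := rateExp p (tiltedLimit p t) t (radius p t)
  obtain ⟨n, h1, hn⟩ := ((hu.eventually_le_ballProb_ball hp t one_pos
    (show 0 < -r / 2 by linarith)).and (eventually_gt_atTop 0)).exists
  have h2 := h1.trans (ballProb_le_one _ _ _)
  rw [← ENNReal.ofReal_one, ENNReal.ofReal_le_ofReal_iff zero_le_one, Real.exp_le_one_iff] at h2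
  have hn' : (0 : ℝ) < n := by exact_mod_cast hn
  have : 0 < (n : ℝ) * (-r - -r / 2) := mul_pos hn' (by linarith)
  linarith

lemma GoodArray.exists_tiltedLimit_mem {p : ℝ} (hp : 1 < p) {u : (n : ℕ) → Fin n → ℝ}
    (hu : GoodArray u) {x : ℝ} (hx : rate p x ≠ ⊤) {O : Set ℝ} (hO : O ∈ 𝓝 x) :
    ∃ t, tiltedLimit p t ∈ O ∧
      (rateExp p (tiltedLimit p t) t (radius p t) : EReal) ≤ rate p x := by
  wlog hx0 : 0 ≤ x generalizing x O
  · rw [← symmetricRate_rate] at hx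
    have hO' : Neg.neg ⁻¹' O ∈ 𝓝 (-x) := continuous_neg.continuousAt.preimage_mem_nhds (by simpa)
    obtain ⟨t, h1, h2⟩ := this hx hO' (by linarith)
    refine ⟨-t, ?_, ?_⟩
    · rwa [tiltedLimit_neg hp]
    · rwa [tiltedLimit_neg hp, radius_neg hp, rateExp_neg_neg, ← symmetricRate_rate]
  have hR : ∀ t, 0 < radius p t := fun t => by linarith [one_le_radius hp t]
  by_cases hA : ∃ t, 0 ≤ t ∧ x ≤ tiltedLimit p t
  · obtain ⟨t, ht, hxt⟩ := hA
    obtain ⟨s, -, hs⟩ := intermediate_value_Icc ht (continuous_tiltedLimit hp).continuousOn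
      ⟨by rwa [tiltedLimit_zero hp], hxt⟩
    rw [← hs] at hO ⊢
    exact ⟨s, mem_of_mem_nhds hO, rateExp_le_rate p _ s (hR s)⟩
  push Not at hA
  obtain ⟨ε, hε, hball⟩ := Metric.mem_nhds_iff.1 hO
  by_cases hB : ∃ t, 0 ≤ t ∧ x - ε < tiltedLimit p t
  · obtain ⟨t, ht, hxt⟩ := hB
    have hlt := hA t ht
    refine ⟨t, hball ?_, le_trans ?_ (rateExp_le_rate p x t (hR t))⟩
    · rw [Metric.mem_ball, Real.dist_eq, abs_lt]
      constructor <;> linarith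
    · rw [rateExp_eq_add p (tiltedLimit p t) x, EReal.coe_le_coe_iff]
      have : 0 ≤ t * radius p t * (x - tiltedLimit p t) :=
        mul_nonneg (mul_nonneg ht (hR t).le) (by linarith)
      linarith
  · exfalso
    push Not at hB
    obtain ⟨r, hr⟩ : ∃ r : ℝ, rate p x = r :=
      ⟨_, (EReal.coe_toReal hx (ne_of_gt (lt_of_lt_of_le (by simp) (rate_nonneg hp x)))).symm⟩
    have ht : 0 ≤ (|r| + 1) / ε := by positivity
    set t := (|r| + 1) / ε
    have h1 := rateExp_le_rate p x t (hR t)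
    rw [hr, EReal.coe_le_coe_iff, rateExp_eq_add p (tiltedLimit p t) x] at h1
    have h2 := hu.rateExp_tiltedLimit_nonneg hp t
    have h3 : t * 1 * ε ≤ t * radius p t * (x - tiltedLimit p t) := by
      have := hB t ht
      have := one_le_radius hp t
      gcongr
      linarith
    have h4 : t * 1 * ε = |r| + 1 := by
      simp only [t]
      field_simp
    linarith [le_abs_self r]

/-! ### The large deviation principle -/

lemma exists_rateExp_gt {p ℓ w s : ℝ} (hs : s = 1 ∨ s = -1) (hw : 0 ≤ s * w)
    (h : (ℓ : EReal) < rate p w) :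
    ∃ t a, 0 ≤ t ∧ 0 < a ∧ ℓ < rateExp p w (s * t) a := by
  obtain ⟨⟨t, ⟨a, ha⟩⟩, hq⟩ := lt_iSup_iff.1 h
  rw [EReal.coe_lt_coe_iff] at hq
  refine ⟨|t|, a, abs_nonneg t, ha, hq.trans_le ?_⟩
  have hk : kappa p (s * |t|) = kappa p t := by
    rcases hs with rfl | rfl <;> rcases abs_choice t with h | h <;> simp [h, kappa_neg]
  have ha' : 0 < a := ha
  have h1 : t * w ≤ s * |t| * w := by
    have h2 : |s * w| = |w| := by rcases hs with rfl | rfl <;> simp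
    rw [abs_of_nonneg hw] at h2
    calc t * w ≤ |t * w| := le_abs_self _
      _ = s * |t| * w := by rw [abs_mul, ← h2]; ring
  have h3 : t * a * w ≤ s * |t| * a * w := by
    nlinarith [mul_le_mul_of_nonneg_left h1 ha'.le]
  simp only [rateExp, hk]
  linarith

lemma GoodArray.eventually_ballProb_halfline_le {p : ℝ} (hp : 1 < p)
    {u : (n : ℕ) → Fin n → ℝ} (hu : GoodArray u) {ℓ w s : ℝ} (hs : s = 1 ∨ s = -1)
    (hw : 0 ≤ s * w) (h : (ℓ : EReal) < rate p w) :
    ∀ᶠ n : ℕ in atTop, ballProb p (u n) {y | s * w ≤ s * y} ≤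
      ENNReal.ofReal (Real.exp (n * -ℓ) / 2) := by
  obtain ⟨t, a, ht, ha, hlt⟩ := exists_rateExp_gt hs hw h
  set g := (rateExp p w (s * t) a - ℓ) / 2 with hg
  have hg0 : 0 < g := by linarith
  have hsmall : ∀ᶠ n : ℕ in atTop, Real.exp (-(n * g)) < 1 / 2 := by
    have : Tendsto (fun n : ℕ => Real.exp (-(n * g))) atTop (𝓝 0) :=
      Real.tendsto_exp_neg_atTop_nhds_zero.comp
        (tendsto_natCast_atTop_atTop.atTop_mul_const hg0)
    exact this.eventually_lt_const (by norm_num)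
  filter_upwards [hu.eventually_ballProb_halfspace_le hp w (s * t) ha hg0, hsmall] with n h1 h2
  have hsub : {y | s * w ≤ s * y} ⊆ {y | s * t * w ≤ s * t * y} := fun y (hy : s * w ≤ s * y) =>
    show s * t * w ≤ s * t * y by nlinarith [mul_le_mul_of_nonneg_left hy ht]
  refine (ballProb_mono p (u n) hsub).trans (h1.trans (ENNReal.ofReal_le_ofReal ?_))
  have : (n : ℝ) * (-rateExp p w (s * t) a + g) = n * -ℓ + -(n * g) := by rw [hg]; ring
  rw [this, Real.exp_add]
  nlinarith [Real.exp_pos (n * -ℓ)]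

lemma GoodArray.eventually_ballProb_inter_halfline_le {p : ℝ} (hp : 1 < p)
    {u : (n : ℕ) → Fin n → ℝ} (hu : GoodArray u) {ℓ s : ℝ} (hs : s = 1 ∨ s = -1) {F : Set ℝ}
    (hF : IsClosed F) (h : ∀ x ∈ F, (ℓ : EReal) < rate p x) :
    ∀ᶠ n : ℕ in atTop, ballProb p (u n) (F ∩ {y | 0 ≤ s * y}) ≤
      ENNReal.ofReal (Real.exp (n * -ℓ) / 2) := by
  rcases (F ∩ {y | 0 ≤ s * y}).eq_empty_or_nonempty with he | hne
  · simp [he, ballProb, ballVol]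
  have hss : s * s = 1 := by rcases hs with rfl | rfl <;> norm_num
  have hG : IsClosed (F ∩ {y | 0 ≤ s * y}) :=
    hF.inter (isClosed_le continuous_const (continuous_const.mul continuous_id))
  have hcl : IsClosed ((s * ·) ⁻¹' (F ∩ {y | 0 ≤ s * y})) :=
    hG.preimage (continuous_const.mul continuous_id)
  have hss' : ∀ y, s * (s * y) = y := fun y => by rw [← mul_assoc, hss, one_mul]
  have hne' : ((s * ·) ⁻¹' (F ∩ {y | 0 ≤ s * y})).Nonempty := by
    obtain ⟨y, hy⟩ := hne
    exact ⟨s * y, by rwa [mem_preimage, hss']⟩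
  have hbdd : BddBelow ((s * ·) ⁻¹' (F ∩ {y | 0 ≤ s * y})) := by
    refine ⟨0, fun y hy => ?_⟩
    have : 0 ≤ s * (s * y) := hy.2
    rwa [hss'] at this
  have hm := hcl.csInf_mem hne' hbdd
  set m := sInf ((s * ·) ⁻¹' (F ∩ {y | 0 ≤ s * y}))
  refine (hu.eventually_ballProb_halfline_le hp hs hm.2 (h _ hm.1)).mono fun n hn =>
    (ballProb_mono p (u n) fun y hy => ?_).trans hn
  have : m ≤ s * y := csInf_le hbdd (by rwa [mem_preimage, hss'])
  simpa [hss'] using this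

lemma GoodArray.eventually_ballProb_le {p : ℝ} (hp : 1 < p)
    {u : (n : ℕ) → Fin n → ℝ} (hu : GoodArray u) {ℓ : ℝ} {F : Set ℝ}
    (hF : IsClosed F) (h : ∀ x ∈ F, (ℓ : EReal) < rate p x) :
    ∀ᶠ n : ℕ in atTop, ballProb p (u n) F ≤ ENNReal.ofReal (Real.exp (n * -ℓ)) := by
  filter_upwards [hu.eventually_ballProb_inter_halfline_le hp (Or.inl rfl) hF h,
    hu.eventually_ballProb_inter_halfline_le hp (Or.inr rfl) hF h] with n h1 h2
  have hsub : F ⊆ (F ∩ {y | 0 ≤ 1 * y}) ∪ (F ∩ {y | 0 ≤ -1 * y}) := fun y hy => by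
    rcases le_total 0 y with h0 | h0
    · exact Or.inl ⟨hy, by simpa using h0⟩
    · exact Or.inr ⟨hy, by simpa using h0⟩
  calc ballProb p (u n) F ≤ _ := (ballProb_mono p (u n) hsub).trans (ballProb_union_le p (u n) _ _)
    _ ≤ _ := add_le_add h1 h2
    _ = ENNReal.ofReal (Real.exp (n * -ℓ)) := by
      rw [← ENNReal.ofReal_add (by positivity) (by positivity), add_halves]

lemma inv_mul_log_ofReal_exp {n : ℕ} (hn : 0 < n) (c : ℝ) :
    (((n : ℝ)⁻¹ : ℝ) : EReal) * ENNReal.log (ENNReal.ofReal (Real.exp (n * c))) = c := by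
  rw [ENNReal.log_ofReal_of_pos (Real.exp_pos _), Real.log_exp, ← EReal.coe_mul,
    inv_mul_cancel_left₀ (by positivity)]

lemma inv_mul_log_mono (n : ℕ) {a b : ℝ≥0∞} (h : a ≤ b) :
    (((n : ℝ)⁻¹ : ℝ) : EReal) * ENNReal.log a ≤ (((n : ℝ)⁻¹ : ℝ) : EReal) * ENNReal.log b :=
  mul_le_mul_of_nonneg_left (ENNReal.log_monotone h) (by exact_mod_cast inv_nonneg.2 n.cast_nonneg)

lemma GoodArray.limsup_le {p : ℝ} (hp : 1 < p)
    {u : (n : ℕ) → Fin n → ℝ} (hu : GoodArray u) {F : Set ℝ} (hF : IsClosed F) :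
    (atTop.limsup fun n : ℕ => (((n : ℝ)⁻¹ : ℝ) : EReal) * ENNReal.log (ballProb p (u n) F)) ≤
      -(⨅ x ∈ F, rate p x) := by
  rw [EReal.le_neg]
  refine EReal.ge_of_forall_gt_iff_ge.1 fun ℓ hℓ => ?_
  rw [EReal.le_neg, ← EReal.coe_neg]
  refine limsup_le_of_le (by isBoundedDefault) ?_
  filter_upwards [hu.eventually_ballProb_le hp hF fun x hx => hℓ.trans_le (iInf₂_le x hx),
    eventually_gt_atTop 0] with n h1 hn
  rw [← inv_mul_log_ofReal_exp hn (-ℓ)]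
  exact inv_mul_log_mono n h1

lemma GoodArray.le_liminf {p : ℝ} (hp : 1 < p)
    {u : (n : ℕ) → Fin n → ℝ} (hu : GoodArray u) {O : Set ℝ} (hO : IsOpen O) :
    -(⨅ x ∈ O, rate p x) ≤
      atTop.liminf fun n : ℕ =>
        (((n : ℝ)⁻¹ : ℝ) : EReal) * ENNReal.log (ballProb p (u n) O) := by
  rw [EReal.neg_le]
  refine le_iInf₂ fun x hx => ?_
  rw [EReal.neg_le]
  by_cases hx' : rate p x = ⊤
  · simp [hx']
  obtain ⟨t, htO, ht⟩ := hu.exists_tiltedLimit_mem hp hx' (hO.mem_nhds hx)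
  refine (EReal.neg_le_neg_iff.2 ht).trans ?_
  obtain ⟨ε, hε, hball⟩ := Metric.isOpen_iff.1 hO _ htO
  refine EReal.ge_of_forall_gt_iff_ge.1 fun c hc => ?_
  rw [← EReal.coe_neg, EReal.coe_lt_coe_iff] at hc
  refine le_liminf_of_le (by isBoundedDefault) ?_
  filter_upwards [hu.eventually_le_ballProb_ball hp t hε (sub_pos.2 hc),
    eventually_gt_atTop 0] with n h1 hn
  rw [← inv_mul_log_ofReal_exp hn c]
  refine inv_mul_log_mono n (le_trans ?_ (h1.trans (ballProb_mono p (u n) hball)))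
  simp

end LDP

/-- Quenched LDP for `p ∈ (1,∞)`, for `σ`-a.e. sequence of directions. -/
theorem statement2
    (p : ℝ) (hp : 1 < p)
    {Ω : Type*} [MeasurableSpace Ω] (P : Measure Ω) [IsProbabilityMeasure P]
    (X : (n : ℕ) → Ω → (Fin n → ℝ))
    (hXmeas : ∀ n, Measurable (X n))
    (hX : ∀ n, 0 < n → Measure.map (X n) P = uniformLpBall n p)
    (σ : Measure ((n : ℕ) → Fin n → ℝ)) [IsProbabilityMeasure σ]
    (hσ : ∀ n, 0 < n → IsUniformSphere (Measure.map (fun θ => θ n) σ)) :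
    (∀ᵐ θ ∂σ, IsLDP P (fun n ω => (n : ℝ) ^ (1/p - 1/2 : ℝ) * dotp (X n ω) (θ n))
        (fun n => (n : ℝ)) (Iq p (muP 2)))
    ∧ (∀ w : ℝ, 0 ≤ Iq p (muP 2) w)
    ∧ HasCompactSublevels (Iq p (muP 2))
    ∧ QuasiconvexRate (Iq p (muP 2))
    ∧ SymmetricRate (Iq p (muP 2)) := by
  have hI : Iq p (muP 2) = rate p := funext (Iq_eq_rate hp)
  rw [hI]
  refine ⟨?_, rate_nonneg hp, hasCompactSublevels_rate p, quasiconvexRate_rate p,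
    symmetricRate_rate p⟩
  filter_upwards [ae_goodArray hσ] with θ hu
  have key (S : Set ℝ) (hS : MeasurableSet S) :
      (fun n : ℕ => (((n : ℝ)⁻¹ : ℝ) : EReal) *
        ENNReal.log (P {ω | (n : ℝ) ^ (1/p - 1/2 : ℝ) * dotp (X n ω) (θ n) ∈ S})) =ᶠ[atTop]
      fun n : ℕ => (((n : ℝ)⁻¹ : ℝ) : EReal) *
        ENNReal.log (ballProb p (fun i => √n * θ n i) S) := by
    filter_upwards [eventually_gt_atTop 0] with n hn
    have hmeas : Measurable fun x : Fin n → ℝ => (n : ℝ) ^ (1/p - 1/2 : ℝ) * dotp x (θ n) := by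
      unfold dotp
      fun_prop
    rw [← uniformLpBall_eq_ballProb hp hn, ← hX n hn, Measure.map_apply (hXmeas n)
      (show MeasurableSet {x | _} from hmeas hS)]
    rfl
  refine ⟨lowerSemicontinuous_rate p, fun Γ _ => ⟨?_, ?_⟩⟩
  · rw [liminf_congr (key _ isOpen_interior.measurableSet)]
    exact hu.le_liminf hp isOpen_interior
  · rw [limsup_congr (key _ isClosed_closure.measurableSet)]
    exact hu.limsup_le hp isClosed_closure
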